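/- Let P ⊂ ℝ² be a finite set of point obstacles and let γ be a piecewise-linear loop whose image is disjoint from P. If δ is a piecewise-linear loop homotopic rel P in the extended sense to γ and δ is locally shortest, then δ has minimal length globally: every piecewise-linear loop homotopic rel P in the extended sense to γ has length at least the length of δ. -/

import Mathlib

/-!
Statement 2: a locally shortest homotopic piecewise-linear loop is globally
shortest.
-/

/-!
Statement 0: existence of a shortest piecewise-linear loop homotopic rel `P`
(in the extended sense) to a given piecewise-linear loop avoiding `P`.
-/

noncomputable section

/-- The Euclidean plane. -/
abbrev Pt : Type := EuclideanSpace ℝ (Fin 2)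

/-- A piecewise-linear loop, given by a cyclic sequence of `m ≥ 1` vertices. -/
structure PLLoop where
  m : ℕ
  m_pos : 0 < m
  v : ZMod m → Pt

/-- The standard 1-periodic parametrization of a piecewise-linear loop: on the
interval `[i/m, (i+1)/m]` it traverses the straight segment from `v i` to `v (i+1)`. -/
def PLLoop.toFun (γ : PLLoop) : ℝ → Pt := fun t =>
  let x : ℝ := Int.fract t * γ.m
  let i : ℤ := ⌊x⌋
  (1 - (x - (i : ℝ))) • γ.v (i : ZMod γ.m) + (x - (i : ℝ)) • γ.v ((i + 1 : ℤ) : ZMod γ.m)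

/-- The length of a piecewise-linear loop: the sum of the Euclidean lengths of
its segments. -/
def PLLoop.length (γ : PLLoop) : ℝ :=
  ∑ i ∈ Finset.range γ.m, dist (γ.v (i : ZMod γ.m)) (γ.v ((i : ZMod γ.m) + 1))

/-- The image of a piecewise-linear loop in the plane. -/
def PLLoop.image (γ : PLLoop) : Set Pt := Set.range γ.toFun

/-- `γ` (avoiding `P`) is homotopic rel `P` in the extended sense to `δ` (which may
meet `P`): there is a continuous `H` on `[0,1] × S¹` (given here via 1-periodic maps
in the second variable) with `H(0,·) = γ`, `H(1,·) = δ`, and the image of `H(t,·)`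
disjoint from `P` for every `t < 1`. -/
def HomotopicRelExt (P : Set Pt) (γ δ : PLLoop) : Prop :=
  ∃ H : ℝ × ℝ → Pt, Continuous H ∧
    (∀ s : ℝ, H (0, s) = γ.toFun s) ∧
    (∀ s : ℝ, H (1, s) = δ.toFun s) ∧
    (∀ t s : ℝ, H (t, s + 1) = H (t, s)) ∧
    (∀ t s : ℝ, 0 ≤ t → t < 1 → H (t, s) ∉ P)



/-- The Fréchet distance between the loops `γ` and `δ` is at most `ε`, witnessed by
an orientation-preserving homeomorphism of the circle (given via a lift
`σ : ℝ → ℝ`, continuous, strictly increasing, with `σ (s+1) = σ s + 1`). -/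
def FrechetLE (γ δ : PLLoop) (ε : ℝ) : Prop :=
  ∃ σ : ℝ → ℝ, Continuous σ ∧ StrictMono σ ∧ (∀ s, σ (s + 1) = σ s + 1) ∧
    ∀ s : ℝ, dist (γ.toFun s) (δ.toFun (σ s)) ≤ ε

/-- `δ`, homotopic rel `P` in the extended sense to `γ`, is locally shortest:
for some `ε > 0`, every piecewise-linear loop homotopic rel `P` in the extended
sense to `γ` and at Fréchet distance at most `ε` from `δ` is at least as long. -/
def IsLocallyShortest (P : Set Pt) (γ δ : PLLoop) : Prop :=
  ∃ ε > (0 : ℝ), ∀ δ' : PLLoop, HomotopicRelExt P γ δ' → FrechetLE δ' δ ε →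
    δ.length ≤ δ'.length

section

/-! ### Conjugacy of cyclically reduced words -/

namespace FreeGroup

variable {α : Type*}

theorem IsCyclicallyReduced.rotate_cons {x : α × Bool} {t : List (α × Bool)}
    (h : IsCyclicallyReduced (x :: t)) : IsCyclicallyReduced (t ++ [x]) := by
  rcases t with _ | ⟨y, t⟩
  · simp
  · obtain ⟨h1, h2⟩ := h
    rw [isReduced_cons_cons] at h1
    have hlast : ∀ a ∈ (y :: t).getLast?, a.1 = x.1 → a.2 = x.2 := by
      intro a ha
      exact h2 a (by simpa [List.getLast?_cons_cons] using ha) x (by simp)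
    refine ⟨?_, ?_⟩
    · refine List.IsChain.append h1.2 (List.isChain_singleton _) ?_
      intro a ha b hb
      obtain rfl : x = b := by simpa using hb
      exact hlast a ha
    · intro a ha b hb
      obtain rfl : x = a := by rw [List.getLast?_concat] at ha; simpa using ha
      obtain rfl : y = b := by simpa using hb
      exact h1.1

theorem IsCyclicallyReduced.rotate {w w' : List (α × Bool)}
    (h : IsCyclicallyReduced w) (hr : w ~r w') : IsCyclicallyReduced w' := by
  obtain ⟨n, rfl⟩ := hr
  induction n with
  | zero => simpa using h
  | succ n ih =>
    rw [← List.rotate_rotate]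
    rcases hw : w.rotate n with _ | ⟨x, t⟩
    · simp
    · rw [hw] at ih
      simpa using ih.rotate_cons

theorem mk_singleton_inv (x : α × Bool) : (mk [x])⁻¹ = mk [(x.1, !x.2)] := by
  simp [inv_mk, invRev]

theorem isConj_mk_of_isRotated {w w' : List (α × Bool)} (h : w ~r w') :
    IsConj (mk w) (mk w') := by
  obtain ⟨n, rfl⟩ := h
  induction n with
  | zero => rw [List.rotate_zero]
  | succ n ih =>
    rw [← List.rotate_rotate]
    refine ih.trans ?_
    rcases w.rotate n with _ | ⟨x, t⟩
    · exact IsConj.refl _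
    · rw [isConj_iff]
      refine ⟨(mk [x])⁻¹, ?_⟩
      have h1 : mk (x :: t) = mk [x] * mk t := by rw [mul_mk]; rfl
      have h2 : mk ((x :: t).rotate 1) = mk t * mk [x] := by rw [mul_mk]; simp
      rw [h1, h2]
      group

theorem isRotated_of_conj_mk (u : List (α × Bool)) (hu : IsReduced u) {w w' : List (α × Bool)}
    (hw : IsCyclicallyReduced w) (hw' : IsCyclicallyReduced w')
    (h : mk w' = mk u * mk w * (mk u)⁻¹) : w' ~r w := by
  classical
  have key : ∀ {a b : List (α × Bool)}, IsReduced a → IsReduced b → mk a = mk b → a = b := by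
    intro a b ha hb hab
    rw [← ha.reduce_eq, ← hb.reduce_eq]
    exact reduce.sound hab
  induction u using List.reverseRecOn generalizing w with
  | nil =>
    have : w' = w := key hw'.1 hw.1 (by simpa [← one_eq_mk] using h)
    rw [this]
  | append_singleton u x ih =>
    have hu' : IsReduced u := (List.isChain_append.1 hu).1
    have hux : mk (u ++ [x]) = mk u * mk [x] := by simp [mul_mk]
    rcases eq_or_ne w [] with rfl | hne
    · have : w' = [] := key hw'.1 (by simp) (by rw [h, ← one_eq_mk]; group)
      rw [this]
    by_cases h1 : ∃ t, w = (x.1, !x.2) :: t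
    · obtain ⟨t, rfl⟩ := h1
      have hrot : (x.1, !x.2) :: t ~r t ++ [(x.1, !x.2)] := ⟨1, by simp⟩
      refine (ih hu' (hw.rotate hrot) ?_).trans hrot.symm
      have e1 : mk (t ++ [(x.1, !x.2)]) = mk t * (mk [x])⁻¹ := by
        rw [mk_singleton_inv, mul_mk]
      have e2 : mk ((x.1, !x.2) :: t) = (mk [x])⁻¹ * mk t := by
        rw [mk_singleton_inv, mul_mk]; rfl
      rw [h, hux, e1, e2]
      group
    by_cases h2 : ∃ t, w = t ++ [x]
    · obtain ⟨t, rfl⟩ := h2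
      have hrot : x :: t ~r t ++ [x] := ⟨1, by simp⟩
      refine (ih hu' (hw.rotate hrot.symm) ?_).trans hrot
      have e1 : mk (t ++ [x]) = mk t * mk [x] := by rw [mul_mk]
      have e2 : mk (x :: t) = mk [x] * mk t := by rw [mul_mk]; rfl
      rw [h, hux, e1, e2]
      group
    exfalso
    have r1 : IsReduced ([x] ++ w) := by
      rcases w with _ | ⟨y, t⟩
      · exact absurd rfl hne
      · rw [List.singleton_append, isReduced_cons_cons]
        refine ⟨fun hxy => ?_, hw.1⟩
        by_contra hne2
        refine h1 ⟨t, ?_⟩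
        have : y = (x.1, !x.2) := by
          ext
          · exact hxy.symm
          · exact Bool.eq_not_of_ne (Ne.symm hne2)
        rw [this]
    have r2 : IsReduced (w ++ [(x.1, !x.2)]) := by
      refine List.IsChain.append hw.1 (List.isChain_singleton _) ?_
      intro a ha b hb hab
      obtain rfl : (x.1, !x.2) = b := by simpa using hb
      by_contra hne2
      refine h2 ⟨w.dropLast, ?_⟩
      have hax : a = x := by
        ext
        · exact hab
        · simpa using Bool.eq_not_of_ne hne2
      rw [← hax]
      exact (List.dropLast_append_getLast? a ha).symm
    have r3 : IsReduced ((u ++ [x]) ++ w) := hu.append_overlap r1 (by simp)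
    have hur : IsReduced (invRev (u ++ [x])) := by
      rw [isReduced_iff_reduce_eq, reduce_invRev, hu.reduce_eq]
    have hinv : invRev (u ++ [x]) = [(x.1, !x.2)] ++ invRev u := by simp [invRev]
    have r4 : IsReduced (w ++ invRev (u ++ [x])) := by
      rw [hinv, ← List.append_assoc]
      exact r2.append_overlap (hinv ▸ hur) (by simp)
    have r5 : IsReduced ((u ++ [x]) ++ w ++ invRev (u ++ [x])) := r3.append_overlap r4 hne
    have e : w' = (u ++ [x]) ++ w ++ invRev (u ++ [x]) :=
      key hw'.1 r5 (by rw [h, inv_mk, mul_mk, mul_mk])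
    rcases hc : u ++ [x] with _ | ⟨y, s⟩
    · simp at hc
    · rw [hc] at e
      have e' : w' = y :: (s ++ w ++ invRev s) ++ [(y.1, !y.2)] := by
        rw [e]; simp [invRev]
      rw [e'] at hw'
      have := (isCyclicallyReduced_cons_append_iff (b := y) (a := (y.1, !y.2)).1 hw').2 rfl
      simp at this

/-- A cyclically reduced word is, up to rotation, a subword of every word representing a conjugate
element. -/
theorem IsCyclicallyReduced.exists_sublist {w W : List (α × Bool)} (hw : IsCyclicallyReduced w)
    (h : IsConj (mk w) (mk W)) : ∃ v, v ~r w ∧ v.Sublist W := by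
  classical
  refine ⟨reduceCyclically (reduce W), ?_, ?_⟩
  · have hred : IsReduced (reduce W) := by
      rw [isReduced_iff_reduce_eq]; exact reduce.idem
    have h2 : IsConj (mk w) (mk (reduceCyclically (reduce W))) := by
      refine h.trans ?_
      rw [← reduce.self (L := W), ← reduceCyclically.conj_conjugator_reduceCyclically (reduce W)]
      apply IsConj.symm
      rw [isConj_iff, reduceCyclically.conj_conjugator_reduceCyclically]
      refine ⟨mk (reduceCyclically.conjugator (reduce W)), ?_⟩
      conv_rhs => rw [← reduceCyclically.conj_conjugator_reduceCyclically (reduce W)]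
      rw [inv_mk, mul_mk, mul_mk]
    obtain ⟨c, hc⟩ := isConj_iff.1 h2
    refine isRotated_of_conj_mk c.toWord isReduced_toWord hw
      (reduceCyclically.isCyclicallyReduced hred) ?_
    rw [mk_toWord, hc]
  · refine List.Sublist.trans ?_ (reduce.red (L := W)).sublist
    conv_rhs => rw [← reduceCyclically.conj_conjugator_reduceCyclically (reduce W)]
    rw [List.append_assoc]
    exact (List.sublist_append_left _ _).trans (List.sublist_append_right _ _)

end FreeGroup

/-! ### Lengths of finite sequences of points -/

section PathLength

variable {X : Type*} [PseudoMetricSpace X]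

/-- Length of the open polygonal path through a list of points. -/
def pathLength : List X → ℝ
  | [] => 0
  | [_] => 0
  | x :: y :: l => dist x y + pathLength (y :: l)

/-- Length of the closed polygonal path through a list of points. -/
def cycleLength : List X → ℝ
  | [] => 0
  | x :: l => pathLength (x :: (l ++ [x]))

theorem pathLength_cons_cons (x y : X) (l : List X) :
    pathLength (x :: y :: l) = dist x y + pathLength (y :: l) := rfl

theorem pathLength_concat (l : List X) (x y : X) :
    pathLength (l ++ [x, y]) = pathLength (l ++ [x]) + dist x y := by
  induction l with
  | nil => simp [pathLength]
  | cons a l ih =>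
    rcases l with _ | ⟨b, l⟩
    · simp [pathLength]
    · simp only [List.cons_append, pathLength_cons_cons] at ih ⊢
      rw [ih]; ring

theorem pathLength_cons_concat_le (x : X) (l : List X) (y z : X) :
    pathLength (x :: (l ++ [y])) ≤ pathLength (x :: (l ++ [z])) + dist z y := by
  induction l generalizing x with
  | nil => simpa [pathLength] using dist_triangle x z y
  | cons a l ih =>
    simp only [List.cons_append, pathLength_cons_cons]
    linarith [ih a]

theorem pathLength_cons_le (x y : X) (l : List X) (z : X) :
    pathLength (x :: (l ++ [z])) ≤ dist x y + pathLength (y :: (l ++ [z])) := by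
  rcases l with _ | ⟨a, l⟩
  · simpa [pathLength] using dist_triangle x y z
  · simp only [List.cons_append, pathLength_cons_cons]
    linarith [dist_triangle x y a]

theorem pathLength_le_of_sublist {l l' : List X} (h : l.Sublist l') (x z : X) :
    pathLength (x :: (l ++ [z])) ≤ pathLength (x :: (l' ++ [z])) := by
  induction h generalizing x with
  | slnil => exact le_rfl
  | cons a _ ih => exact (pathLength_cons_le x a _ z).trans (by
      simp only [List.cons_append, pathLength_cons_cons]; linarith [ih a])
  | cons_cons a _ ih =>
      simp only [List.cons_append, pathLength_cons_cons]; linarith [ih a]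

theorem pathLength_nonneg (l : List X) : 0 ≤ pathLength l := by
  induction l with
  | nil => exact le_rfl
  | cons a l ih =>
    rcases l with _ | ⟨b, l⟩
    · exact le_rfl
    · rw [pathLength_cons_cons]; positivity

theorem cycleLength_nonneg (l : List X) : 0 ≤ cycleLength l := by
  rcases l with _ | ⟨b, l⟩
  · exact le_rfl
  · exact pathLength_nonneg _

theorem cycleLength_le_of_sublist {l l' : List X} (h : l.Sublist l') :
    cycleLength l ≤ cycleLength l' := by
  induction h with
  | slnil => exact le_rfl
  | @cons l l' a _ ih =>
    refine ih.trans ?_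
    rcases l' with _ | ⟨y, t⟩
    · exact cycleLength_nonneg _
    · simp only [cycleLength, List.cons_append, pathLength_cons_cons]
      linarith [pathLength_cons_concat_le y t y a]
  | cons_cons a h _ => exact pathLength_le_of_sublist h a a

theorem cycleLength_rotate (l : List X) (n : ℕ) : cycleLength (l.rotate n) = cycleLength l := by
  induction n with
  | zero => simp
  | succ n ih =>
    rw [← List.rotate_rotate, ← ih]
    rcases l.rotate n with _ | ⟨x, t⟩
    · simp
    · rcases t with _ | ⟨y, t⟩
      · simp
      · simp only [List.rotate_cons_succ, List.rotate_zero, List.cons_append, cycleLength,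
          pathLength_cons_cons, List.append_assoc, List.nil_append]
        have := pathLength_concat (y :: t) x y
        simp only [List.cons_append] at this
        rw [this]; ring

theorem pathLength_map_range (f : ℕ → X) (n : ℕ) :
    pathLength ((List.range (n + 1)).map f) = ∑ i ∈ Finset.range n, dist (f i) (f (i + 1)) := by
  induction n with
  | zero => simp [pathLength]
  | succ n ih =>
    rw [Finset.sum_range_succ, ← ih, List.range_succ, List.range_succ, List.map_append,
      List.map_append]
    simp only [List.map_cons, List.map_nil, List.append_assoc, List.singleton_append]
    rw [pathLength_concat]

theorem cycleLength_map_range (f : ℕ → X) (n : ℕ) (h : f n = f 0) :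
    cycleLength ((List.range n).map f) = ∑ i ∈ Finset.range n, dist (f i) (f (i + 1)) := by
  rw [← pathLength_map_range]
  rcases n with _ | n
  · simp [cycleLength, pathLength]
  · rw [List.range_succ (n := n + 1), List.map_append, List.map_singleton, h,
      List.range_succ_eq_map]
    simp [cycleLength]

theorem cycleLength_eq_pathLength_getLast (l : List X) (h : l ≠ []) :
    cycleLength l = pathLength (l.getLast h :: l) := by
  rcases List.eq_nil_or_concat l with rfl | ⟨t, a, rfl⟩
  · exact absurd rfl h
  · rw [← cycleLength_rotate _ t.length]
    simp [List.concat_eq_append, cycleLength]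

end PathLength

end

section

open Set Filter Topology

/-! ### Polygonal loops and straight-line homotopies -/

theorem continuous_interpolate_int {E : Type*} [AddCommGroup E] [Module ℝ E] [TopologicalSpace E]
    [ContinuousAdd E] [ContinuousSMul ℝ E] (w : ℤ → E) :
    Continuous fun y : ℝ => (1 - Int.fract y) • w ⌊y⌋ + Int.fract y • w (⌊y⌋ + 1) := by
  have hlf : LocallyFinite fun n : ℤ => Icc (n : ℝ) (n + 1) := by
    intro y
    refine ⟨Ioo (y - 1) (y + 1), Ioo_mem_nhds (by linarith) (by linarith), ?_⟩
    refine (Set.finite_Icc (⌊y⌋ - 3) (⌊y⌋ + 3)).subset ?_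
    rintro n ⟨z, ⟨h1, h2⟩, h3, h4⟩
    have h5 := Int.floor_le y
    have h6 := Int.lt_floor_add_one y
    constructor
    · have : ((⌊y⌋ - 3 : ℤ) : ℝ) ≤ n := by push_cast; linarith
      exact_mod_cast this
    · have : (n : ℝ) ≤ ((⌊y⌋ + 3 : ℤ) : ℝ) := by push_cast; linarith
      exact_mod_cast this
  refine hlf.continuous ?_ (fun n => isClosed_Icc) fun n => ?_
  · refine eq_univ_of_forall fun y => mem_iUnion.2
      ⟨⌊y⌋, Int.floor_le y, (Int.lt_floor_add_one y).le⟩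
  · have : ContinuousOn (fun y : ℝ => (1 - (y - n)) • w n + (y - n) • w (n + 1))
        (Icc (n : ℝ) (n + 1)) := by fun_prop
    refine this.congr fun y hy => ?_
    rcases hy.2.eq_or_lt with h | h
    · subst h
      have : ⌊(n : ℝ) + 1⌋ = n + 1 := by simp
      simp [this]
    · have : ⌊y⌋ = n := Int.floor_eq_iff.2 ⟨hy.1, h⟩
      simp only [Int.fract, this]

namespace PLLoop

theorem toFun_eq_interpolate (γ : PLLoop) (s : ℝ) :
    γ.toFun s = (1 - Int.fract (s * γ.m)) • γ.v (⌊s * γ.m⌋ : ℤ) +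
      Int.fract (s * γ.m) • γ.v ((⌊s * γ.m⌋ + 1 : ℤ) : ZMod γ.m) := by
  have e : s * γ.m = Int.fract s * γ.m + ((⌊s⌋ * γ.m : ℤ) : ℝ) := by
    push_cast; rw [← add_mul, Int.fract_add_floor]
  have h1 : ⌊s * γ.m⌋ = ⌊Int.fract s * γ.m⌋ + ⌊s⌋ * γ.m := by rw [e, Int.floor_add_intCast]
  have h2 : Int.fract (s * γ.m) = Int.fract s * γ.m - ⌊Int.fract s * γ.m⌋ := by
    rw [e, Int.fract_add_intCast]; rfl
  rw [h1, h2]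
  simp [toFun]

theorem continuous_toFun (γ : PLLoop) : Continuous γ.toFun := by
  have := (continuous_interpolate_int fun i : ℤ => γ.v (i : ZMod γ.m)).comp
    (continuous_mul_const (γ.m : ℝ))
  refine this.congr fun s => ?_
  rw [toFun_eq_interpolate]; rfl

theorem toFun_add_one (γ : PLLoop) (s : ℝ) : γ.toFun (s + 1) = γ.toFun s := by
  simp [toFun]

theorem toFun_of_mem_Icc (γ : PLLoop) (k : ℤ) {s : ℝ} (h1 : (k : ℝ) ≤ s * γ.m)
    (h2 : s * γ.m ≤ k + 1) :
    γ.toFun s = (1 - (s * γ.m - k)) • γ.v k + (s * γ.m - k) • γ.v (k + 1) := by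
  rw [toFun_eq_interpolate]
  rcases h2.eq_or_lt with h | h
  · rw [h]
    have : ⌊(k : ℝ) + 1⌋ = k + 1 := by simp
    simp [this]
  · have : ⌊s * γ.m⌋ = k := Int.floor_eq_iff.2 ⟨h1, h⟩
    simp [Int.fract, this]

/-- The parameter `s` falls on a definite edge, at a definite proportion, which only depend on the
number of vertices. -/
theorem exists_toFun_eq (n : ℕ) (s : ℝ) : ∃ (i : ZMod n) (u : ℝ), 0 ≤ u ∧ u ≤ 1 ∧
    ∀ (hn : 0 < n) (v : ZMod n → Pt),
      toFun ⟨n, hn, v⟩ s = (1 - u) • v i + u • v (i + 1) := by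
  refine ⟨(⌊s * n⌋ : ℤ), Int.fract (s * n), Int.fract_nonneg _, (Int.fract_lt_one _).le, ?_⟩
  intro hn v
  rw [toFun_eq_interpolate]
  simp

end PLLoop

/-- Homotopy of 1-periodic curves through curves that avoid `P`, except possibly the last one. -/
def HomotopicCurves (P : Set Pt) (f g : ℝ → Pt) : Prop :=
  ∃ H : ℝ × ℝ → Pt, Continuous H ∧ (∀ s, H (0, s) = f s) ∧ (∀ s, H (1, s) = g s) ∧
    (∀ t s : ℝ, H (t, s + 1) = H (t, s)) ∧ ∀ t s : ℝ, 0 ≤ t → t < 1 → H (t, s) ∉ P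

theorem HomotopicCurves.lineTo {P : Set Pt} {f g h : ℝ → Pt} (H : HomotopicCurves P f g)
    (hg : Continuous g) (hh : Continuous h) (hg1 : ∀ s, g (s + 1) = g s)
    (hh1 : ∀ s, h (s + 1) = h s)
    (hP : ∀ t s : ℝ, 0 ≤ t → t < 1 → (1 - t) • g s + t • h s ∉ P) : HomotopicCurves P f h := by
  obtain ⟨F, hF, F0, F1, F2, F3⟩ := H
  refine ⟨fun x => if x.1 ≤ 1 / 2 then F (2 * x.1, x.2) else
    (1 - (2 * x.1 - 1)) • g x.2 + (2 * x.1 - 1) • h x.2, ?_, ?_, ?_, ?_, ?_⟩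
  · refine Continuous.if_le ?_ ?_ continuous_fst continuous_const ?_
    · fun_prop
    · fun_prop
    · rintro ⟨t, s⟩ ht
      simp only at ht
      subst ht
      norm_num [F1]
  · intro s; simp [F0]
  · intro s; norm_num
  · intro t s
    by_cases ht : t ≤ 1 / 2 <;> simp only [ht, if_true, if_false, F2, hg1, hh1]
  · intro t s h0 h1
    by_cases ht : t ≤ 1 / 2
    · simp only [ht, if_true]
      rcases ht.eq_or_lt with rfl | h
      · have := hP 0 s le_rfl one_pos
        simpa [F1] using this
      · exact F3 _ _ (by linarith) (by linarith)
    · simp only [ht, if_false]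
      exact hP _ _ (by linarith) (by linarith)

theorem homotopicRelExt_iff {P : Set Pt} {γ δ : PLLoop} :
    HomotopicRelExt P γ δ ↔ HomotopicCurves P γ.toFun δ.toFun := Iff.rfl

/-- Straight-line homotopy between polygons with the same number of vertices. -/
theorem HomotopicRelExt.lineTo {P : Set Pt} {γ : PLLoop} {n : ℕ} {hn : 0 < n}
    {v w : ZMod n → Pt} (H : HomotopicRelExt P γ ⟨n, hn, v⟩)
    (hP : ∀ t : ℝ, 0 ≤ t → t < 1 → ∀ (i : ZMod n) (u : ℝ), 0 ≤ u → u ≤ 1 →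
      (1 - u) • ((1 - t) • v i + t • w i) + u • ((1 - t) • v (i + 1) + t • w (i + 1)) ∉ P) :
    HomotopicRelExt P γ ⟨n, hn, w⟩ := by
  refine HomotopicCurves.lineTo (homotopicRelExt_iff.1 H) (PLLoop.continuous_toFun _)
    (PLLoop.continuous_toFun _) (PLLoop.toFun_add_one _) (PLLoop.toFun_add_one _) ?_
  intro t s h0 h1
  obtain ⟨i, u, hu0, hu1, h⟩ := PLLoop.exists_toFun_eq n s
  rw [h hn v, h hn w]
  have e : (1 - t) • ((1 - u) • v i + u • v (i + 1)) + t • ((1 - u) • w i + u • w (i + 1)) =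
      (1 - u) • ((1 - t) • v i + t • w i) + u • ((1 - t) • v (i + 1) + t • w (i + 1)) := by module
  rw [e]
  exact hP t h0 h1 i u hu0 hu1

theorem frechetLE_of_dist_le {n : ℕ} {hn : 0 < n} {X Y : ZMod n → Pt} {δ : PLLoop} {ε ε' : ℝ}
    (hX : ∀ s, dist (PLLoop.toFun ⟨n, hn, X⟩ s) (δ.toFun s) ≤ ε)
    (hY : ∀ i, dist (Y i) (X i) ≤ ε') : FrechetLE ⟨n, hn, Y⟩ δ (ε' + ε) := by
  refine ⟨id, continuous_id, strictMono_id, fun s => rfl, fun s => ?_⟩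
  refine (dist_triangle _ (PLLoop.toFun ⟨n, hn, X⟩ s) _).trans (add_le_add ?_ (hX s))
  obtain ⟨i, u, hu0, hu1, h⟩ := PLLoop.exists_toFun_eq n s
  rw [h hn, h hn, dist_eq_norm]
  have : (1 - u) • Y i + u • Y (i + 1) - ((1 - u) • X i + u • X (i + 1)) =
      (1 - u) • (Y i - X i) + u • (Y (i + 1) - X (i + 1)) := by module
  rw [this]
  refine (norm_add_le _ _).trans ?_
  rw [norm_smul, norm_smul, Real.norm_of_nonneg hu0, Real.norm_of_nonneg (by linarith : 0 ≤ 1 - u),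
    ← dist_eq_norm, ← dist_eq_norm]
  nlinarith [hY i, hY (i + 1)]

theorem PLLoop.length_convex {n : ℕ} (hn : 0 < n) (X Y : ZMod n → Pt) {t : ℝ} (h0 : 0 ≤ t)
    (h1 : t ≤ 1) :
    PLLoop.length ⟨n, hn, fun i => (1 - t) • X i + t • Y i⟩ ≤
      (1 - t) * PLLoop.length ⟨n, hn, X⟩ + t * PLLoop.length ⟨n, hn, Y⟩ := by
  simp only [PLLoop.length, Finset.mul_sum, ← Finset.sum_add_distrib]
  refine Finset.sum_le_sum fun i _ => ?_
  rw [dist_eq_norm, dist_eq_norm, dist_eq_norm]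
  have : ∀ a b c d : Pt, (1 - t) • a + t • b - ((1 - t) • c + t • d) =
      (1 - t) • (a - c) + t • (b - d) := by intros; module
  rw [this]
  refine (norm_add_le _ _).trans ?_
  rw [norm_smul, norm_smul, Real.norm_of_nonneg h0, Real.norm_of_nonneg (by linarith : 0 ≤ 1 - t)]

/-- If all convex combinations of `X` with `Y` are admissible and `X` is close to the locally
shortest loop `δ` and not longer, then `Y` is at least as long as `δ`. -/
theorem IsLocallyShortest.le_length {P : Set Pt} {γ δ : PLLoop} {ε : ℝ}
    (hloc : ∀ δ' : PLLoop, HomotopicRelExt P γ δ' → FrechetLE δ' δ ε → δ.length ≤ δ'.length)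
    {n : ℕ} {hn : 0 < n} {X Y : ZMod n → Pt} (hε : 0 < ε)
    (hX : ∀ s, dist (PLLoop.toFun ⟨n, hn, X⟩ s) (δ.toFun s) ≤ ε / 2)
    (hlen : PLLoop.length ⟨n, hn, X⟩ ≤ δ.length)
    (hXY : ∀ t : ℝ, 0 < t → t ≤ 1 →
      HomotopicRelExt P γ ⟨n, hn, fun i => (1 - t) • X i + t • Y i⟩) :
    δ.length ≤ PLLoop.length ⟨n, hn, Y⟩ := by
  have : NeZero n := ⟨hn.ne'⟩
  obtain ⟨B, hB⟩ := (Set.finite_range fun i => dist (Y i) (X i)).bddAbove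
  have hB' : ∀ i, dist (Y i) (X i) ≤ B := fun i => hB ⟨i, rfl⟩
  have hB0 : 0 ≤ B := dist_nonneg.trans (hB' 0)
  obtain ⟨t, ht0, ht1, htB⟩ : ∃ t : ℝ, 0 < t ∧ t ≤ 1 ∧ t * B ≤ ε / 2 := by
    refine ⟨min 1 (ε / 2 / (B + 1)), by positivity, min_le_left _ _, ?_⟩
    calc _ ≤ (ε / 2 / (B + 1)) * (B + 1) :=
          mul_le_mul (min_le_right _ _) (by linarith) hB0 (by positivity)
      _ = _ := by field_simp
  have h := hloc _ (hXY t ht0 ht1) (by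
    have := frechetLE_of_dist_le (Y := fun i => (1 - t) • X i + t • Y i) (ε' := ε / 2) hX
      (fun i => by
        have : (1 - t) • X i + t • Y i - X i = t • (Y i - X i) := by module
        rw [dist_eq_norm, this, norm_smul, Real.norm_of_nonneg ht0.le, ← dist_eq_norm]
        exact (mul_le_mul_of_nonneg_left (hB' i) ht0.le).trans htB)
    rwa [add_halves] at this)
  have h2 := PLLoop.length_convex hn X Y ht0.le ht1
  nlinarith

end

section

open Set Filter Topology

/-! ### Slabs, gates and words -/

/-- A (generic) linear coordinate on the plane; together with `z 1` it determines the point `z`. -/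
def skewCoord (c : ℝ) (z : Pt) : ℝ := z 0 + c * z 1

theorem skewCoord_combo (c t : ℝ) (a b : Pt) :
    skewCoord c ((1 - t) • a + t • b) = (1 - t) * skewCoord c a + t * skewCoord c b := by
  simp [skewCoord]; ring

theorem apply_one_combo (t : ℝ) (a b : Pt) :
    ((1 - t) • a + t • b) 1 = (1 - t) * a 1 + t * b 1 := by
  simp

theorem continuous_skewCoord (c : ℝ) : Continuous (skewCoord c) := by
  unfold skewCoord; fun_prop

/-- The point with given coordinates. -/
def skewPoint (c x y : ℝ) : Pt := !₂[x - c * y, y]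

@[simp] theorem skewCoord_skewPoint (c x y : ℝ) : skewCoord c (skewPoint c x y) = x := by
  simp [skewCoord, skewPoint]

@[simp] theorem skewPoint_apply_one (c x y : ℝ) : skewPoint c x y 1 = y := by
  simp [skewPoint]

theorem ext_skewCoord {c : ℝ} {z w : Pt} (h : skewCoord c z = skewCoord c w) (h1 : z 1 = w 1) :
    z = w := by
  ext i
  fin_cases i
  · simp only [skewCoord, h1] at h
    simpa using h
  · simpa using h1

/-- An oriented gate: an obstacle, one of the two vertical rays issuing from it (`true` for the
upper one), and a crossing direction (`true` for increasing `skewCoord`). -/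
abbrev Gate : Type := (Pt × Bool) × Bool

namespace Gate

/-- The closed ray of the gate. -/
def ray (c : ℝ) (a : Gate) : Set Pt :=
  {z | skewCoord c z = skewCoord c a.1.1 ∧ if a.1.2 then a.1.1 1 ≤ z 1 else z 1 ≤ a.1.1 1}

/-- The open ray of the gate. -/
def openRay (c : ℝ) (a : Gate) : Set Pt :=
  {z | skewCoord c z = skewCoord c a.1.1 ∧ if a.1.2 then a.1.1 1 < z 1 else z 1 < a.1.1 1}

/-- The slab from which the gate is crossed, labelled by the obstacles to its left. -/
def src (c : ℝ) (P : Set Pt) (a : Gate) : Set Pt :=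
  if a.2 then {q ∈ P | skewCoord c q < skewCoord c a.1.1}
  else {q ∈ P | skewCoord c q ≤ skewCoord c a.1.1}

/-- The gate crossed in the opposite direction. -/
def rev (a : Gate) : Gate := (a.1, !a.2)

/-- The slab to which the gate leads. -/
def tgt (c : ℝ) (P : Set Pt) (a : Gate) : Set Pt := a.rev.src c P

theorem tgt_rev (c : ℝ) (P : Set Pt) (a : Gate) : a.rev.tgt c P = a.src c P := by
  simp [tgt, rev]

theorem openRay_subset_ray (c : ℝ) (a : Gate) : a.openRay c ⊆ a.ray c := by
  rintro z ⟨h1, h2⟩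
  refine ⟨h1, ?_⟩
  split_ifs at h2 ⊢ <;> exact h2.le

theorem openRay_nonempty (c : ℝ) (a : Gate) : (a.openRay c).Nonempty := by
  rcases h : a.1.2
  · exact ⟨skewPoint c (skewCoord c a.1.1) (a.1.1 1 - 1), by simp [openRay, h]⟩
  · exact ⟨skewPoint c (skewCoord c a.1.1) (a.1.1 1 + 1), by simp [openRay, h]⟩

theorem notMem_of_mem_openRay {c : ℝ} {P : Set Pt} (hc : InjOn (skewCoord c) P) {a : Gate}
    (ha : a.1.1 ∈ P) {z : Pt} (hz : z ∈ a.openRay c) : z ∉ P := by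
  intro hzP
  have := hc hzP ha hz.1
  have h2 := hz.2
  rw [this] at h2
  simp at h2

theorem combo_mem_ray {c : ℝ} {a : Gate} {z w : Pt} {t : ℝ} (hz : z ∈ a.ray c) (hw : w ∈ a.ray c)
    (h0 : 0 ≤ t) (h1 : t ≤ 1) : (1 - t) • z + t • w ∈ a.ray c := by
  obtain ⟨hz1, hz2⟩ := hz
  obtain ⟨hw1, hw2⟩ := hw
  refine ⟨?_, ?_⟩
  · rw [skewCoord_combo, hz1, hw1]; ring
  · rw [apply_one_combo]
    split_ifs at hz2 hw2 ⊢ <;> nlinarith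

theorem combo_mem_openRay {c : ℝ} {a : Gate} {z w : Pt} {t : ℝ} (hz : z ∈ a.ray c)
    (hw : w ∈ a.openRay c) (h0 : 0 < t) (h1 : t ≤ 1) : (1 - t) • z + t • w ∈ a.openRay c := by
  obtain ⟨hz1, hz2⟩ := hz
  obtain ⟨hw1, hw2⟩ := hw
  refine ⟨?_, ?_⟩
  · rw [skewCoord_combo, hz1, hw1]; ring
  · rw [apply_one_combo]
    split_ifs at hz2 hw2 ⊢ <;> nlinarith

end Gate

/-- The closed slab with the obstacles of `σ` on its left and the others on its right. -/
def slab (c : ℝ) (P σ : Set Pt) : Set Pt :=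
  {z | ∀ q ∈ P, (q ∈ σ → skewCoord c q ≤ skewCoord c z) ∧ (q ∉ σ → skewCoord c z ≤ skewCoord c q)}

/-- The open slab with the obstacles of `σ` on its left and the others on its right. -/
def openSlab (c : ℝ) (P σ : Set Pt) : Set Pt :=
  {z | ∀ q ∈ P, (q ∈ σ → skewCoord c q < skewCoord c z) ∧ (q ∉ σ → skewCoord c z < skewCoord c q)}

theorem openSlab_subset_slab (c : ℝ) (P σ : Set Pt) : openSlab c P σ ⊆ slab c P σ :=
  fun _ hz q hq => ⟨fun h => ((hz q hq).1 h).le, fun h => ((hz q hq).2 h).le⟩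

theorem notMem_of_mem_openSlab {c : ℝ} {P σ : Set Pt} {z : Pt} (hz : z ∈ openSlab c P σ) :
    z ∉ P := by
  intro h
  by_cases hs : z ∈ σ
  · exact lt_irrefl _ ((hz z h).1 hs)
  · exact lt_irrefl _ ((hz z h).2 hs)

theorem combo_mem_slab {c : ℝ} {P σ : Set Pt} {z w : Pt} {t : ℝ} (hz : z ∈ slab c P σ)
    (hw : w ∈ slab c P σ) (h0 : 0 ≤ t) (h1 : t ≤ 1) : (1 - t) • z + t • w ∈ slab c P σ := by
  intro q hq
  rw [skewCoord_combo]
  exact ⟨fun h => by nlinarith [(hz q hq).1 h, (hw q hq).1 h],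
    fun h => by nlinarith [(hz q hq).2 h, (hw q hq).2 h]⟩

theorem combo_mem_openSlab {c : ℝ} {P σ : Set Pt} {z w : Pt} {t : ℝ} (hz : z ∈ slab c P σ)
    (hw : w ∈ openSlab c P σ) (h0 : 0 < t) (h1 : t ≤ 1) :
    (1 - t) • z + t • w ∈ openSlab c P σ := by
  intro q hq
  rw [skewCoord_combo]
  exact ⟨fun h => by nlinarith [(hz q hq).1 h, (hw q hq).1 h],
    fun h => by nlinarith [(hz q hq).2 h, (hw q hq).2 h]⟩

theorem combo_mem_openSlab' {c : ℝ} {P σ : Set Pt} {z w : Pt} {t : ℝ} (hz : z ∈ openSlab c P σ)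
    (hw : w ∈ slab c P σ) (h0 : 0 ≤ t) (h1 : t < 1) :
    (1 - t) • z + t • w ∈ openSlab c P σ := by
  have := combo_mem_openSlab hw hz (t := 1 - t) (by linarith) (by linarith)
  rwa [sub_sub_cancel, add_comm] at this

theorem Gate.ray_subset_slab_src (c : ℝ) (P : Set Pt) (a : Gate) :
    a.ray c ⊆ slab c P (a.src c P) := by
  rintro z ⟨hz, -⟩ q hq
  rw [hz]
  unfold Gate.src
  split_ifs
  · exact ⟨fun h => h.2.le, fun h => not_lt.1 fun h' => h ⟨hq, h'⟩⟩
  · exact ⟨fun h => h.2, fun h => (not_le.1 fun h' => h ⟨hq, h'⟩).le⟩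

theorem Gate.ray_subset_slab_tgt (c : ℝ) (P : Set Pt) (a : Gate) :
    a.ray c ⊆ slab c P (a.tgt c P) :=
  a.rev.ray_subset_slab_src c P

/-- A cyclic itinerary: at each index, the label of the current slab and possibly a gate
to cross. -/
structure GateWord (n : ℕ) where
  gate : ZMod n → Option Gate
  label : ZMod n → Set Pt

namespace GateWord

variable {c : ℝ} {P : Set Pt} {n : ℕ}

/-- The closed set in which the vertex with index `i` is allowed to move. -/
def cell (c : ℝ) (P : Set Pt) (W : GateWord n) (i : ZMod n) : Set Pt :=
  match W.gate i with
  | none => slab c P (W.label i)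
  | some a => a.ray c

/-- The relatively open version of `GateWord.cell`. -/
def openCell (c : ℝ) (P : Set Pt) (W : GateWord n) (i : ZMod n) : Set Pt :=
  match W.gate i with
  | none => openSlab c P (W.label i)
  | some a => a.openRay c

theorem cell_none {W : GateWord n} {i : ZMod n} (h : W.gate i = none) :
    W.cell c P i = slab c P (W.label i) := by simp [cell, h]

theorem cell_some {W : GateWord n} {i : ZMod n} {a : Gate} (h : W.gate i = some a) :
    W.cell c P i = a.ray c := by simp [cell, h]

theorem openCell_none {W : GateWord n} {i : ZMod n} (h : W.gate i = none) :
    W.openCell c P i = openSlab c P (W.label i) := by simp [openCell, h]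

theorem openCell_some {W : GateWord n} {i : ZMod n} {a : Gate} (h : W.gate i = some a) :
    W.openCell c P i = a.openRay c := by simp [openCell, h]

theorem openCell_subset_cell (W : GateWord n) (i : ZMod n) : W.openCell c P i ⊆ W.cell c P i := by
  rcases h : W.gate i with _ | a
  · rw [openCell_none h, cell_none h]; exact openSlab_subset_slab c P _
  · rw [openCell_some h, cell_some h]; exact a.openRay_subset_ray c

theorem combo_mem_cell {W : GateWord n} {i : ZMod n} {z w : Pt} {t : ℝ} (hz : z ∈ W.cell c P i)
    (hw : w ∈ W.cell c P i) (h0 : 0 ≤ t) (h1 : t ≤ 1) : (1 - t) • z + t • w ∈ W.cell c P i := by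
  rcases h : W.gate i with _ | a
  · rw [cell_none h] at *; exact combo_mem_slab hz hw h0 h1
  · rw [cell_some h] at *; exact Gate.combo_mem_ray hz hw h0 h1

theorem combo_mem_openCell {W : GateWord n} {i : ZMod n} {z w : Pt} {t : ℝ}
    (hz : z ∈ W.cell c P i) (hw : w ∈ W.openCell c P i) (h0 : 0 < t) (h1 : t ≤ 1) :
    (1 - t) • z + t • w ∈ W.openCell c P i := by
  rcases h : W.gate i with _ | a
  · rw [cell_none h] at *; rw [openCell_none h] at *; exact combo_mem_openSlab hz hw h0 h1
  · rw [cell_some h] at *; rw [openCell_some h] at *; exact Gate.combo_mem_openRay hz hw h0 h1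

/-- Consistency of an itinerary. -/
structure Valid (c : ℝ) (P : Set Pt) (W : GateWord n) : Prop where
  label_add_one_of_none : ∀ i, W.gate i = none → W.label (i + 1) = W.label i
  mem_of_some : ∀ i a, W.gate i = some a → a.1.1 ∈ P
  label_of_some : ∀ i a, W.gate i = some a → W.label i = a.src c P
  label_add_one_of_some : ∀ i a, W.gate i = some a → W.label (i + 1) = a.tgt c P
  openSlab_nonempty : ∀ i, (openSlab c P (W.label i)).Nonempty
  spaced : ∀ i, W.gate i = none ∨ W.gate (i + 1) = none

theorem Valid.cell_subset_slab {W : GateWord n} (hW : W.Valid c P) (i : ZMod n) :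
    W.cell c P i ⊆ slab c P (W.label i) := by
  rcases h : W.gate i with _ | a
  · rw [cell_none h]
  · rw [cell_some h, hW.label_of_some i a h]; exact a.ray_subset_slab_src c P

theorem Valid.cell_subset_slab_add_one {W : GateWord n} (hW : W.Valid c P) (i : ZMod n) :
    W.cell c P i ⊆ slab c P (W.label (i + 1)) := by
  rcases h : W.gate i with _ | a
  · rw [cell_none h, hW.label_add_one_of_none i h]
  · rw [cell_some h, hW.label_add_one_of_some i a h]; exact a.ray_subset_slab_tgt c P

theorem Valid.notMem_of_mem_openCell {W : GateWord n} (hW : W.Valid c P)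
    (hc : InjOn (skewCoord c) P) {i : ZMod n} {z : Pt} (hz : z ∈ W.openCell c P i) : z ∉ P := by
  rcases h : W.gate i with _ | a
  · rw [openCell_none h] at hz; exact notMem_of_mem_openSlab hz
  · rw [openCell_some h] at hz; exact Gate.notMem_of_mem_openRay hc (hW.mem_of_some i a h) hz

theorem Valid.combo_notMem {W : GateWord n} (hW : W.Valid c P) (hc : InjOn (skewCoord c) P)
    {i : ZMod n} {z w : Pt} {t : ℝ} (hz : z ∈ W.openCell c P i)
    (hw : w ∈ W.openCell c P (i + 1)) (h0 : 0 ≤ t) (h1 : t ≤ 1) : (1 - t) • z + t • w ∉ P := by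
  have hz' := hW.cell_subset_slab_add_one i (W.openCell_subset_cell i hz)
  have hw' := hW.cell_subset_slab (i + 1) (W.openCell_subset_cell (i + 1) hw)
  rcases hW.spaced i with h | h
  · rcases h1.eq_or_lt with rfl | h1
    · simpa using hW.notMem_of_mem_openCell hc hw
    · rw [openCell_none h, ← hW.label_add_one_of_none i h] at hz
      exact notMem_of_mem_openSlab (combo_mem_openSlab' hz hw' h0 h1)
  · rcases h0.eq_or_lt with rfl | h0
    · simpa using hW.notMem_of_mem_openCell hc hz
    · rw [openCell_none h] at hw
      exact notMem_of_mem_openSlab (combo_mem_openSlab hz' hw h0 h1)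

theorem Valid.openCell_nonempty {W : GateWord n} (hW : W.Valid c P) (i : ZMod n) :
    (W.openCell c P i).Nonempty := by
  rcases h : W.gate i with _ | a
  · rw [openCell_none h]; exact hW.openSlab_nonempty i
  · rw [openCell_some h]; exact a.openRay_nonempty c

/-- Every polygon that follows the itinerary `W` is homotopic to `γ`. -/
def Realizes (c : ℝ) (P : Set Pt) (γ : PLLoop) [NeZero n] (W : GateWord n) : Prop :=
  ∀ Y : ZMod n → Pt, (∀ i, Y i ∈ W.cell c P i) →
    HomotopicRelExt P γ ⟨n, Nat.pos_of_neZero n, Y⟩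

theorem Valid.realizes {γ : PLLoop} [NeZero n] {W : GateWord n} (hW : W.Valid c P)
    (hc : InjOn (skewCoord c) P) {Y₀ : ZMod n → Pt} (hY₀ : ∀ i, Y₀ i ∈ W.cell c P i)
    (hP : ∀ i (u : ℝ), 0 ≤ u → u ≤ 1 → (1 - u) • Y₀ i + u • Y₀ (i + 1) ∉ P)
    (h : HomotopicRelExt P γ ⟨n, Nat.pos_of_neZero n, Y₀⟩) : W.Realizes c P γ := by
  intro Y hY
  choose b hb using hW.openCell_nonempty
  have h1 : HomotopicRelExt P γ ⟨n, Nat.pos_of_neZero n, b⟩ := by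
    refine h.lineTo fun t ht0 ht1 i u hu0 hu1 => ?_
    rcases ht0.eq_or_lt with rfl | ht0
    · simpa using hP i u hu0 hu1
    · exact hW.combo_notMem hc (combo_mem_openCell (hY₀ i) (hb i) ht0 ht1.le)
        (combo_mem_openCell (hY₀ _) (hb _) ht0 ht1.le) hu0 hu1
  refine h1.lineTo fun t ht0 ht1 i u hu0 hu1 => ?_
  have key : ∀ i, (1 - t) • b i + t • Y i ∈ W.openCell c P i := fun i => by
    have := combo_mem_openCell (hY i) (hb i) (t := 1 - t) (by linarith) (by linarith)
    rwa [sub_sub_cancel, add_comm] at this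
  exact hW.combo_notMem hc (key i) (key _) hu0 hu1

/-- The gates of an itinerary, in order. -/
def letters (W : GateWord n) : List Gate :=
  (List.range n).filterMap fun j : ℕ => W.gate (j : ZMod n)

end GateWord

end

section

open Set Filter Topology

/-! ### Cyclic sums and words over `ZMod n` -/

theorem sum_range_zmod_add {n : ℕ} [NeZero n] (f : ZMod n → ℝ) (a : ZMod n) :
    ∑ j ∈ Finset.range n, f (a + (j : ℕ)) = ∑ i, f i := by
  rw [← Equiv.sum_comp (Equiv.addLeft a) f]
  refine Finset.sum_bij (fun j _ => (j : ZMod n)) (fun _ _ => Finset.mem_univ _) ?_ ?_ ?_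
  · intro i hi j hj h
    have := congrArg ZMod.val h
    simpa [ZMod.val_natCast, Nat.mod_eq_of_lt (Finset.mem_range.1 hi),
      Nat.mod_eq_of_lt (Finset.mem_range.1 hj)] using this
  · intro b _
    exact ⟨b.val, Finset.mem_range.2 (ZMod.val_lt b), ZMod.natCast_zmod_val b⟩
  · intro j _; rfl

theorem PLLoop.length_eq_sum_add {n : ℕ} [NeZero n] (hn : 0 < n) (X : ZMod n → Pt) (a : ZMod n) :
    PLLoop.length ⟨n, hn, X⟩ =
      ∑ j ∈ Finset.range n, dist (X (a + (j : ℕ))) (X (a + (j + 1 : ℕ))) := by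
  have h1 := sum_range_zmod_add (fun i => dist (X i) (X (i + 1))) 0
  have h2 := sum_range_zmod_add (fun i => dist (X i) (X (i + 1))) a
  simp only [zero_add] at h1
  rw [PLLoop.length]
  simp only [Nat.cast_add, Nat.cast_one, ← add_assoc]
  rw [h1, h2]

theorem val_add_sub_cast {n : ℕ} [NeZero n] (a : ZMod n) {j : ℕ} (hj : j < n) :
    (a + (j : ZMod n) - a).val = j := by
  rw [add_sub_cancel_left, ZMod.val_natCast, Nat.mod_eq_of_lt hj]

theorem exists_eq_add_cast {n : ℕ} [NeZero n] (a i : ZMod n) : ∃ j < n, i = a + (j : ℕ) :=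
  ⟨(i - a).val, ZMod.val_lt _, by simp⟩

section FilterMapRange

variable {β : Type*}

theorem isRotated_filterMap_range {n : ℕ} [NeZero n] (f : ZMod n → Option β) (a : ZMod n) :
    ((List.range n).filterMap fun j : ℕ => f (j : ZMod n)) ~r
      ((List.range n).filterMap fun j : ℕ => f (a + (j : ZMod n))) := by
  obtain ⟨r, -, rfl⟩ := exists_eq_add_cast 0 a
  induction r with
  | zero => simp [List.IsRotated.refl]
  | succ r ih =>
    refine ih.trans ?_
    obtain ⟨m, hm⟩ := Nat.exists_eq_succ_of_ne_zero (NeZero.ne n)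
    have hr1 : List.range n = [0] ++ (List.range m).map Nat.succ := by
      rw [hm, Nat.succ_eq_add_one, List.range_succ_eq_map, List.singleton_append]
    have hr2 : List.range n = List.range m ++ [m] := by
      rw [hm, Nat.succ_eq_add_one, List.range_succ]
    have e1 : List.filterMap (fun j : ℕ => f (0 + (r : ℕ) + (j : ℕ))) [0] =
        List.filterMap (fun j : ℕ => f (0 + (r + 1 : ℕ) + (j : ℕ))) [m] := by
      have : ((r + 1 : ℕ) : ZMod n) + (m : ℕ) = r := by
        have : ((m + 1 : ℕ) : ZMod n) = 0 := by
          rw [← Nat.succ_eq_add_one, ← hm, ZMod.natCast_self]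
        push_cast at this ⊢
        linear_combination this
      simp only [List.filterMap_cons, List.filterMap_nil, zero_add, this]
      simp
    have e2 : List.filterMap (fun j : ℕ => f (0 + (r : ℕ) + (j : ℕ))) (List.map Nat.succ
        (List.range m)) = List.filterMap (fun j : ℕ => f (0 + (r + 1 : ℕ) + (j : ℕ)))
        (List.range m) := by
      rw [List.filterMap_map]
      congr 1
      funext j
      simp only [Function.comp]
      congr 1
      push_cast
      ring
    conv_lhs => rw [hr1, List.filterMap_append, e1, e2]
    conv_rhs => rw [hr2, List.filterMap_append]
    exact List.isRotated_append

theorem exists_of_getLast?_filterMap_range (f : ℕ → Option β) (n : ℕ) {x : β}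
    (h : ((List.range n).filterMap f).getLast? = some x) :
    ∃ i < n, f i = some x ∧ ∀ k, i < k → k < n → f k = none := by
  induction n with
  | zero => simp at h
  | succ n ih =>
    rw [List.range_succ, List.filterMap_append] at h
    rcases hf : f n with _ | y
    · simp only [List.filterMap_cons, hf, List.filterMap_nil, List.append_nil] at h
      obtain ⟨i, hi, h1, h2⟩ := ih h
      refine ⟨i, by omega, h1, fun k hk hk' => ?_⟩
      rcases (Nat.lt_succ_iff.1 hk').eq_or_lt with rfl | h3
      · exact hf
      · exact h2 k hk h3
    · simp only [List.filterMap_cons, hf, List.filterMap_nil, List.getLast?_concat] at h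
      exact ⟨n, by omega, by rw [hf, h], fun k h1 h2 => by omega⟩

theorem exists_of_head?_filterMap_range (f : ℕ → Option β) (n : ℕ) {x : β}
    (h : ((List.range n).filterMap f).head? = some x) :
    ∃ i < n, f i = some x ∧ ∀ k < i, f k = none := by
  induction n with
  | zero => simp at h
  | succ n ih =>
    rw [List.range_succ, List.filterMap_append] at h
    rcases hl : (List.range n).filterMap f with _ | ⟨y, l⟩
    · rw [hl, List.nil_append] at h
      rw [List.filterMap_eq_nil_iff] at hl
      refine ⟨n, by omega, ?_, fun k hk => hl k (List.mem_range.2 hk)⟩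
      rcases hf : f n with _ | y
      · simp [hf] at h
      · simpa [hf] using h
    · rw [hl] at h ih
      obtain ⟨i, hi, h1⟩ := ih (by simpa using h)
      exact ⟨i, by omega, h1⟩

theorem isChain_filterMap_range (R : β → β → Prop) (f : ℕ → Option β) (n : ℕ)
    (h : ∀ i j x y, i < j → j < n → f i = some x → f j = some y →
      (∀ k, i < k → k < j → f k = none) → R x y) :
    ((List.range n).filterMap f).IsChain R := by
  induction n with
  | zero => simp
  | succ n ih =>
    rw [List.range_succ, List.filterMap_append]
    refine List.IsChain.append (ih fun i j x y h1 h2 => h i j x y h1 (by omega)) ?_ ?_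
    · rcases hf : f n with _ | y <;> simp [hf]
    · intro x hx y hy
      obtain ⟨i, hi, h1, h2⟩ := exists_of_getLast?_filterMap_range f n hx
      have hy : f n = some y := by
        rcases hf : f n with _ | y' <;> simp_all
      exact h i n x y hi (by omega) h1 hy h2

end FilterMapRange

namespace GateWord

variable {c : ℝ} {P : Set Pt} {n : ℕ}

/-- A word that is not cyclically reduced crosses some gate and recrosses it immediately. -/
theorem exists_backtrack {W : GateWord n} (h : ¬ FreeGroup.IsCyclicallyReduced W.letters) :
    ∃ (a : ZMod n) (k : ℕ) (g : Gate), 0 < k ∧ k < n ∧ W.gate a = some g ∧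
      (∀ j : ℕ, 0 < j → j < k → W.gate (a + j) = none) ∧ W.gate (a + k) = some g.rev := by
  by_contra! hno
  have hno' : ∀ (a : ZMod n) (k : ℕ) (g g' : Gate), 0 < k → k < n → W.gate a = some g →
      (∀ j : ℕ, 0 < j → j < k → W.gate (a + j) = none) → W.gate (a + k) = some g' →
      g.1 = g'.1 → g.2 = g'.2 := by
    intro a k g g' h1 h2 h3 h4 h5 h6
    by_contra h7
    refine hno a k g h1 h2 h3 h4 (h5.trans ?_)
    congr 1
    exact Prod.ext h6.symm (Bool.eq_not_of_ne (Ne.symm h7))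
  have hchain : FreeGroup.IsReduced W.letters := by
    refine isChain_filterMap_range _ _ _ ?_
    intro i j x y hij hj hx hy hk
    refine hno' i (j - i) x y (by omega) (by omega) hx ?_ ?_
    · intro l h1 h2
      rw [← Nat.cast_add]
      exact hk _ (by omega) (by omega)
    · rw [← Nat.cast_add, Nat.add_sub_cancel' hij.le]; exact hy
  refine h ⟨hchain, ?_⟩
  · intro x hx y hy
    obtain ⟨i, hi, h1, h2⟩ := exists_of_getLast?_filterMap_range _ _ hx
    obtain ⟨j, hj, h3, h4⟩ := exists_of_head?_filterMap_range _ _ hy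
    rcases lt_trichotomy i j with hij | rfl | hij
    · rw [h4 i hij] at h1; cases h1
    · rw [h1] at h3; cases h3; exact fun _ => rfl
    have cast_eq : ∀ m : ℕ, n ≤ m → ((m : ℕ) : ZMod n) = ((m - n : ℕ) : ZMod n) := fun m hm => by
      rw [Nat.cast_sub hm]; simp
    refine hno' i (n - i + j) x y (by omega) (by omega) h1 ?_ ?_
    · intro l hl1 hl2
      rw [← Nat.cast_add]
      rcases lt_or_ge (i + l) n with h | h
      · exact h2 _ (by omega) h
      · rw [cast_eq _ h]; exact h4 _ (by omega)
    · rw [← Nat.cast_add, cast_eq _ (by omega)]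
      rw [← h3]
      congr 2
      omega

/-- A backtracking piece of a word and its properties. -/
structure Backtrack (W : GateWord n) (a : ZMod n) (k : ℕ) (g : Gate) : Prop where
  pos : 0 < k
  lt : k < n
  first : W.gate a = some g
  middle : ∀ j : ℕ, 0 < j → j < k → W.gate (a + j) = none
  last : W.gate (a + k) = some g.rev

variable {W : GateWord n} {a : ZMod n} {k : ℕ} {g : Gate}

theorem Backtrack.label_middle (h : W.Backtrack a k g) (hW : W.Valid c P) {j : ℕ} (h0 : 0 < j)
    (hj : j ≤ k) : W.label (a + j) = g.tgt c P := by
  induction j with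
  | zero => omega
  | succ j ih =>
    rw [Nat.cast_succ, ← add_assoc]
    rcases Nat.eq_zero_or_pos j with rfl | h1
    · simpa using hW.label_add_one_of_some a g h.first
    · rw [hW.label_add_one_of_none _ (h.middle j h1 (by omega)), ih h1 (by omega)]

theorem Backtrack.ray_subset_cell [NeZero n] (h : W.Backtrack a k g) (hW : W.Valid c P) {j : ℕ}
    (hj : j ≤ k) : g.ray c ⊆ W.cell c P (a + j) := by
  rcases Nat.eq_zero_or_pos j with rfl | h1
  · rw [Nat.cast_zero, add_zero, cell_some h.first]
  rcases hj.eq_or_lt with rfl | h2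
  · rw [cell_some h.last]; rfl
  · rw [cell_none (h.middle j h1 h2), h.label_middle hW h1 hj]
    exact g.ray_subset_slab_tgt c P

/-- A path in which shortcutting does not help is contained in the segment between its ends. -/
theorem wbtw_of_sum_dist_le {X : ℕ → Pt} {k : ℕ}
    (h : ∑ j ∈ Finset.range k, dist (X j) (X (j + 1)) ≤ dist (X 0) (X k)) {j : ℕ} (hj : j ≤ k) :
    Wbtw ℝ (X 0) (X j) (X k) := by
  rw [← dist_add_dist_eq_iff]
  refine le_antisymm ?_ (dist_triangle _ _ _)
  have h1 := dist_le_range_sum_dist X j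
  have h2 := dist_le_Ico_sum_dist X hj
  rw [← Finset.sum_range_add_sum_Ico _ hj] at h
  linarith

/-- In a shortest configuration, the vertices of a backtracking piece lie on the gate. -/
theorem Backtrack.mem_ray [NeZero n] (h : W.Backtrack a k g) (hW : W.Valid c P)
    {X : ZMod n → Pt}
    (hX : ∀ i, X i ∈ W.cell c P i)
    (hmin : ∀ Y : ZMod n → Pt, (∀ i, Y i ∈ W.cell c P i) →
      PLLoop.length ⟨n, Nat.pos_of_neZero n, X⟩ ≤ PLLoop.length ⟨n, Nat.pos_of_neZero n, Y⟩)
    {j : ℕ} (hj : j ≤ k) : X (a + j) ∈ g.ray c := by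
  classical
  have hXa : X a ∈ g.ray c := by have := hX a; rwa [cell_some h.first] at this
  have hXk : X (a + k) ∈ g.ray c := by have := hX (a + k); rwa [cell_some h.last] at this
  let Y : ZMod n → Pt := fun i => if (i - a).val < k then X a else X i
  have hY : ∀ i, Y i ∈ W.cell c P i := by
    intro i
    obtain ⟨j, hj, rfl⟩ := exists_eq_add_cast a i
    simp only [Y, val_add_sub_cast a hj]
    split_ifs with h1
    · exact h.ray_subset_cell hW h1.le hXa
    · exact hX _
  have hlen := hmin Y hY
  rw [PLLoop.length_eq_sum_add _ X a, PLLoop.length_eq_sum_add _ Y a,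
    ← Finset.sum_range_add_sum_Ico _ h.lt.le, ← Finset.sum_range_add_sum_Ico _ h.lt.le] at hlen
  have Y_lt : ∀ j, j < k → Y (a + j) = X a := fun j hj => by
    simp only [Y, val_add_sub_cast a (hj.trans h.lt), hj, if_true]
  have Y_ge : ∀ j, k ≤ j → j ≤ n → Y (a + j) = X (a + j) := fun j hj hj' => by
    rcases hj'.eq_or_lt with rfl | hj'
    · simp [Y]
    · simp only [Y, val_add_sub_cast a hj', not_lt.2 hj, if_false]
  have e1 : ∑ j ∈ Finset.Ico k n, dist (Y (a + (j : ℕ))) (Y (a + (j + 1 : ℕ))) =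
      ∑ j ∈ Finset.Ico k n, dist (X (a + (j : ℕ))) (X (a + (j + 1 : ℕ))) := by
    refine Finset.sum_congr rfl fun j hj => ?_
    rw [Finset.mem_Ico] at hj
    rw [Y_ge j hj.1 hj.2.le, Y_ge (j + 1) (by omega) (by omega)]
  have e2 : ∑ j ∈ Finset.range k, dist (Y (a + (j : ℕ))) (Y (a + (j + 1 : ℕ))) =
      dist (X a) (X (a + k)) := by
    obtain ⟨m, rfl⟩ := Nat.exists_eq_succ_of_ne_zero h.pos.ne'
    rw [Nat.succ_eq_add_one, Finset.sum_range_succ, Finset.sum_eq_zero, zero_add,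
      Y_lt m (by omega), Y_ge (m + 1) le_rfl h.lt.le]
    intro j hj
    rw [Finset.mem_range] at hj
    rw [Y_lt j (by omega), Y_lt (j + 1) (by omega), dist_self]
  rw [e1, e2, add_le_add_iff_right] at hlen
  have hw := wbtw_of_sum_dist_le (X := fun j => X (a + j)) (k := k) (by simpa using hlen) hj
  obtain ⟨t, ⟨h0, h1⟩, ht⟩ := hw
  rw [AffineMap.lineMap_apply_module] at ht
  simp only [Nat.cast_zero, add_zero] at ht
  rw [← ht]
  exact Gate.combo_mem_ray hXa hXk h0 h1

open Classical in
/-- Remove a backtracking piece by staying on the first side of the gate. -/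
def erase (c : ℝ) (P : Set Pt) (W : GateWord n) (a : ZMod n) (k : ℕ) (g : Gate) : GateWord n where
  gate i := if (i - a).val ≤ k then none else W.gate i
  label i := if (i - a).val ≤ k then g.src c P else W.label i

theorem erase_gate_of_le {j : ℕ} (hj : j ≤ k) (hk : k < n) :
    (W.erase c P a k g).gate (a + j) = none := by
  simp [erase, ZMod.val_natCast, Nat.mod_eq_of_lt (hj.trans_lt hk), hj]

theorem erase_gate_of_lt {j : ℕ} (hj : k < j) (hn : j < n) :
    (W.erase c P a k g).gate (a + j) = W.gate (a + j) := by
  simp [erase, ZMod.val_natCast, Nat.mod_eq_of_lt hn, hj]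

theorem erase_label_of_le {j : ℕ} (hj : j ≤ k) (hk : k < n) :
    (W.erase c P a k g).label (a + j) = g.src c P := by
  simp [erase, ZMod.val_natCast, Nat.mod_eq_of_lt (hj.trans_lt hk), hj]

theorem Backtrack.erase_label_of_lt [NeZero n] (h : W.Backtrack a k g) (hW : W.Valid c P) {j : ℕ}
    (hj : k < j) (hn : j ≤ n) :
    (W.erase c P a k g).label (a + j) = W.label (a + j) := by
  rcases hn.eq_or_lt with rfl | hn
  · simp [erase, hW.label_of_some a g h.first]
  · simp [erase, ZMod.val_natCast, Nat.mod_eq_of_lt hn, hj]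

theorem Backtrack.erase_valid [NeZero n] (h : W.Backtrack a k g) (hW : W.Valid c P) :
    (W.erase c P a k g).Valid c P := by
  have hlt := h.lt
  have add_one : ∀ j : ℕ, a + (j : ZMod n) + 1 = a + (j + 1 : ℕ) := fun j => by push_cast; ring
  constructor
  · intro i hi
    obtain ⟨j, hj, rfl⟩ := exists_eq_add_cast a i
    rw [add_one]
    rcases lt_trichotomy j k with hjk | rfl | hjk
    · rw [erase_label_of_le hjk hlt, erase_label_of_le hjk.le hlt]
    · rw [erase_label_of_le le_rfl hlt, h.erase_label_of_lt hW (by omega) (by omega), ← add_one,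
        hW.label_add_one_of_some _ _ h.last, Gate.tgt_rev]
    · rw [h.erase_label_of_lt hW hjk hj.le, h.erase_label_of_lt hW (by omega) (by omega), ← add_one]
      rw [erase_gate_of_lt hjk hj] at hi
      exact hW.label_add_one_of_none _ hi
  · intro i b hb
    obtain ⟨j, hj, rfl⟩ := exists_eq_add_cast a i
    rcases le_or_gt j k with hjk | hjk
    · rw [erase_gate_of_le hjk hlt] at hb; cases hb
    · rw [erase_gate_of_lt hjk hj] at hb; exact hW.mem_of_some _ _ hb
  · intro i b hb
    obtain ⟨j, hj, rfl⟩ := exists_eq_add_cast a i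
    rcases le_or_gt j k with hjk | hjk
    · rw [erase_gate_of_le hjk hlt] at hb; cases hb
    · rw [erase_gate_of_lt hjk hj] at hb
      rw [h.erase_label_of_lt hW hjk hj.le, hW.label_of_some _ _ hb]
  · intro i b hb
    obtain ⟨j, hj, rfl⟩ := exists_eq_add_cast a i
    rcases le_or_gt j k with hjk | hjk
    · rw [erase_gate_of_le hjk hlt] at hb; cases hb
    · rw [erase_gate_of_lt hjk hj] at hb
      rw [add_one, h.erase_label_of_lt hW (by omega) (by omega), ← add_one,
        hW.label_add_one_of_some _ _ hb]
  · intro i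
    simp only [erase]
    split_ifs
    · rw [← hW.label_of_some a g h.first]; exact hW.openSlab_nonempty a
    · exact hW.openSlab_nonempty i
  · intro i
    simp only [erase]
    rcases hW.spaced i with h1 | h1 <;> simp [h1]

theorem Backtrack.mem_cell_erase [NeZero n] (h : W.Backtrack a k g) (hW : W.Valid c P)
    {X : ZMod n → Pt}
    (hX : ∀ j : ℕ, k < j → j < n → X (a + j) ∈ W.cell c P (a + j))
    (hXr : ∀ j : ℕ, j ≤ k → X (a + j) ∈ g.ray c) (i : ZMod n) :
    X i ∈ (W.erase c P a k g).cell c P i := by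
  obtain ⟨j, hj, rfl⟩ := exists_eq_add_cast a i
  rcases le_or_gt j k with hjk | hjk
  · rw [cell_none (erase_gate_of_le hjk h.lt), erase_label_of_le hjk h.lt]
    exact g.ray_subset_slab_src c P (hXr j hjk)
  · have := hX j hjk hj
    simp only [cell, erase_gate_of_lt hjk hj, h.erase_label_of_lt hW hjk hj.le] at this ⊢
    exact this

theorem Backtrack.erase_realizes [NeZero n] (h : W.Backtrack a k g) (hW : W.Valid c P) {γ : PLLoop}
    (hc : InjOn (skewCoord c) P) (hr : W.Realizes c P γ) :
    (W.erase c P a k g).Realizes c P γ := by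
  classical
  choose b hb using hW.openCell_nonempty
  obtain ⟨q, hq⟩ := g.openRay_nonempty c
  let Y : ZMod n → Pt := fun i => if (i - a).val ≤ k then q else b i
  have Y_le : ∀ j : ℕ, j ≤ k → Y (a + j) = q := fun j hj => by
    simp only [Y, val_add_sub_cast a (hj.trans_lt h.lt), hj, if_true]
  have Y_gt : ∀ j : ℕ, k < j → j < n → Y (a + j) = b (a + j) := fun j hj hn => by
    simp only [Y, val_add_sub_cast a hn, not_le.2 hj, if_false]
  have Y_open : ∀ j : ℕ, j = 0 ∨ k ≤ j → j ≤ n → Y (a + j) ∈ W.openCell c P (a + j) := by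
    have zero : Y a ∈ W.openCell c P a := by
      rw [openCell_some h.first]
      have := Y_le 0 (by omega)
      simp only [Nat.cast_zero, add_zero] at this
      rwa [this]
    rintro j (rfl | hj) hn
    · simpa using zero
    rcases hn.eq_or_lt with rfl | hn
    · simpa using zero
    rcases hj.eq_or_lt with rfl | hj
    · rw [openCell_some h.last, Y_le _ le_rfl]; exact hq
    · rw [Y_gt j hj hn]; exact hb _
  refine (h.erase_valid hW).realizes hc (Y₀ := Y) ?_ ?_ (hr Y ?_)
  · refine h.mem_cell_erase hW (fun j hj hn => ?_) fun j hj => ?_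
    · rw [Y_gt j hj hn]; exact W.openCell_subset_cell _ (hb _)
    · rw [Y_le j hj]; exact g.openRay_subset_ray c hq
  · intro i u h0 h1
    obtain ⟨j, hj, rfl⟩ := exists_eq_add_cast a i
    have add_one : a + (j : ZMod n) + 1 = a + (j + 1 : ℕ) := by push_cast; ring
    rcases lt_or_ge j k with hjk | hjk
    · rw [add_one, Y_le j hjk.le, Y_le (j + 1) hjk, ← add_smul, sub_add_cancel, one_smul]
      exact Gate.notMem_of_mem_openRay hc (hW.mem_of_some a g h.first) hq
    · refine hW.combo_notMem hc (Y_open j (Or.inr hjk) hj.le) ?_ h0 h1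
      rw [add_one]
      exact Y_open (j + 1) (by omega) (by omega)
  · intro i
    obtain ⟨j, hj, rfl⟩ := exists_eq_add_cast a i
    rcases le_or_gt j k with hjk | hjk
    · rw [Y_le j hjk]; exact h.ray_subset_cell hW hjk (g.openRay_subset_ray c hq)
    · rw [Y_gt j hjk hj]; exact W.openCell_subset_cell _ (hb _)

theorem Backtrack.exists_letters [NeZero n] (h : W.Backtrack a k g) :
    ∃ l, W.letters ~r g :: g.rev :: l ∧ (W.erase c P a k g).letters ~r l := by
  have hlt := h.lt
  obtain ⟨m, hm⟩ := Nat.exists_eq_add_of_lt hlt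
  obtain ⟨k', rfl⟩ := Nat.exists_eq_succ_of_ne_zero h.pos.ne'
  have hm' : n = k' + 1 + 1 + m := by omega
  have hr : List.range n = List.range (k' + 1 + 1) ++ (List.range m).map (k' + 1 + 1 + ·) := by
    rw [hm', List.range_add]
  refine ⟨((List.range m).map (k' + 1 + 1 + ·)).filterMap fun j : ℕ => W.gate (a + (j : ZMod n)),
    ?_, ?_⟩
  · refine (isRotated_filterMap_range W.gate a).trans ?_
    rw [hr, List.filterMap_append, List.range_succ, List.filterMap_append,
      List.range_succ_eq_map, ← List.singleton_append, List.filterMap_append]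
    have e1 : List.filterMap (fun j : ℕ => W.gate (a + (j : ℕ))) [0] = [g] := by
      simp [h.first]
    have e2 : List.filterMap (fun j : ℕ => W.gate (a + (j : ℕ))) [k' + 1] = [g.rev] := by
      have := h.last
      simp only [List.filterMap_cons, List.filterMap_nil, Nat.succ_eq_add_one] at this ⊢
      rw [this]
    have e3 : List.filterMap (fun j : ℕ => W.gate (a + (j : ℕ)))
        (List.map Nat.succ (List.range k')) = [] := by
      rw [List.filterMap_eq_nil_iff]
      intro j hj
      obtain ⟨i, hi, rfl⟩ := List.mem_map.1 hj
      exact h.middle _ (by omega) (by have := List.mem_range.1 hi; omega)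
    rw [e1, e2, e3]
    exact List.IsRotated.refl _
  · refine (isRotated_filterMap_range (W.erase c P a (k' + 1) g).gate a).trans ?_
    rw [hr, List.filterMap_append]
    have e1 : List.filterMap (fun j : ℕ => (W.erase c P a (k' + 1) g).gate (a + (j : ℕ)))
        (List.range (k' + 1 + 1)) = [] := by
      rw [List.filterMap_eq_nil_iff]
      intro j hj
      exact erase_gate_of_le (Nat.lt_succ_iff.1 (List.mem_range.1 hj)) hlt
    rw [e1, List.nil_append]
    rw [List.filterMap_congr (g := fun j : ℕ => W.gate (a + (j : ℕ)))]
    intro j hj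
    obtain ⟨i, hi, rfl⟩ := List.mem_map.1 hj
    exact erase_gate_of_lt (by omega) (by have := List.mem_range.1 hi; omega)

/-- Among the itineraries through which a given configuration `X`, shortest for all of them, can be
threaded, there is one which is cyclically reduced. -/
theorem exists_isCyclicallyReduced [NeZero n] {γ : PLLoop} (hc : InjOn (skewCoord c) P)
    {X : ZMod n → Pt} (W : GateWord n) (hW : W.Valid c P) (hr : W.Realizes c P γ) (hX : ∀ i, X i ∈ W.cell c P i)
    (hmin : ∀ W : GateWord n, W.Valid c P → W.Realizes c P γ → (∀ i, X i ∈ W.cell c P i) →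
      ∀ Y : ZMod n → Pt, (∀ i, Y i ∈ W.cell c P i) →
        PLLoop.length ⟨n, Nat.pos_of_neZero n, X⟩ ≤ PLLoop.length ⟨n, Nat.pos_of_neZero n, Y⟩) :
    ∃ W' : GateWord n, W'.Valid c P ∧ W'.Realizes c P γ ∧ (∀ i, X i ∈ W'.cell c P i) ∧
      FreeGroup.IsCyclicallyReduced W'.letters ∧
      IsConj (FreeGroup.mk W'.letters) (FreeGroup.mk W.letters) := by
  induction hN : W.letters.length using Nat.strong_induction_on generalizing W with
  | _ N ih =>
    by_cases hred : FreeGroup.IsCyclicallyReduced W.letters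
    · exact ⟨W, hW, hr, hX, hred, IsConj.refl _⟩
    obtain ⟨a, k, g, h1, h2, h3, h4, h5⟩ := exists_backtrack hred
    have h : W.Backtrack a k g := ⟨h1, h2, h3, h4, h5⟩
    obtain ⟨l, hl1, hl2⟩ := h.exists_letters (c := c) (P := P)
    have hlen : (W.erase c P a k g).letters.length < N := by
      rw [hl2.perm.length_eq, ← hN, hl1.perm.length_eq]
      simp
    obtain ⟨W', g1, g2, g3, g4, g5⟩ := ih _ hlen _ (h.erase_valid hW) (h.erase_realizes hW hc hr)
      (h.mem_cell_erase hW (fun j _ _ => hX _)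
        fun j hj => h.mem_ray hW hX (hmin W hW hr hX) hj) rfl
    refine ⟨W', g1, g2, g3, g4, g5.trans ?_⟩
    refine (FreeGroup.isConj_mk_of_isRotated hl2).trans
      (IsConj.trans ?_ (FreeGroup.isConj_mk_of_isRotated hl1).symm)
    have : FreeGroup.mk (g :: g.rev :: l) = FreeGroup.mk l :=
      Quot.sound FreeGroup.Red.Step.cons_not
    rw [this]

end GateWord

end

section

open Set Filter Topology

/-! ### Threading a polygon through a subword -/

theorem pathLength_cons_append_singleton {X : Type*} [PseudoMetricSpace X] (x y : X) (l : List X) :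
    pathLength (x :: (l ++ [y])) =
      pathLength (x :: l) + dist ((x :: l).getLast (List.cons_ne_nil _ _)) y := by
  rcases List.eq_nil_or_concat l with rfl | ⟨t, a, rfl⟩
  · simp [pathLength]
  · have := pathLength_concat (x :: t) a y
    simp only [List.concat_eq_append, List.append_assoc, List.singleton_append] at *
    simpa using this

/-- Expand a list of marked points to a sequence which stays put at unmarked times. -/
theorem exists_expansion {α X : Type*} [PseudoMetricSpace X] (f : ℕ → Option α) (p₀ : X) (n : ℕ)
    (D : List (α × X)) (hD : D.map Prod.fst = (List.range n).filterMap f) :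
    ∃ Z : ℕ → X, Z 0 = p₀ ∧ (∀ j < n, f j = none → Z (j + 1) = Z j) ∧
      (∀ j < n, ∀ a, f j = some a → (a, Z (j + 1)) ∈ D) ∧
      Z n = (p₀ :: D.map Prod.snd).getLast (List.cons_ne_nil _ _) ∧
      ∑ j ∈ Finset.range n, dist (Z j) (Z (j + 1)) = pathLength (p₀ :: D.map Prod.snd) := by
  induction n generalizing D with
  | zero =>
    obtain rfl : D = [] := by simpa using hD
    exact ⟨fun _ => p₀, rfl, by simp, by simp, rfl, by simp [pathLength]⟩
  | succ n ih =>
    rw [List.range_succ, List.filterMap_append] at hD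
    rcases hf : f n with _ | a
    · simp only [List.filterMap_cons, hf, List.filterMap_nil, List.append_nil] at hD
      obtain ⟨Z, h0, h1, h2, h3, h4⟩ := ih D hD
      refine ⟨fun j => Z (min j n), by simpa using h0, ?_, ?_, by simpa using h3, ?_⟩
      · intro j hj hfj
        rcases (Nat.lt_succ_iff.1 hj).eq_or_lt with rfl | hj
        · simp
        · have := h1 j hj hfj
          simp only
          rwa [min_eq_left (by omega), min_eq_left (by omega)]
      · intro j hj b hfj
        rcases (Nat.lt_succ_iff.1 hj).eq_or_lt with rfl | hj
        · rw [hf] at hfj; cases hfj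
        · have := h2 j hj b hfj
          simpa only [min_eq_left (Nat.succ_le_of_lt hj)] using this
      · rw [Finset.sum_range_succ, ← h4]
        simp only [min_self, Nat.le_succ, inf_of_le_right, dist_self, add_zero]
        refine Finset.sum_congr rfl fun j hj => ?_
        rw [Finset.mem_range] at hj
        rw [min_eq_left (by omega), min_eq_left (by omega)]
    · simp only [List.filterMap_cons, hf, List.filterMap_nil] at hD
      obtain ⟨D₀, D₁, rfl, hD₀, hD₁⟩ := List.map_eq_append_iff.1 hD
      obtain ⟨⟨b, y⟩, rfl, rfl⟩ : ∃ q, D₁ = [q] ∧ q.1 = a := by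
        rcases D₁ with _ | ⟨q, _ | ⟨q', D₁⟩⟩
        · simp at hD₁
        · exact ⟨q, rfl, by simpa using hD₁⟩
        · simp at hD₁
      obtain ⟨Z, h0, h1, h2, h3, h4⟩ := ih D₀ hD₀
      refine ⟨fun j => if j ≤ n then Z j else y, by simpa using h0, ?_, ?_, ?_, ?_⟩
      · intro j hj hfj
        rcases (Nat.lt_succ_iff.1 hj).eq_or_lt with rfl | hj
        · rw [hf] at hfj; cases hfj
        · have := h1 j hj hfj
          simpa only [hj.le, Nat.succ_le_of_lt hj, if_true] using this
      · intro j hj b hfj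
        rcases (Nat.lt_succ_iff.1 hj).eq_or_lt with rfl | hj
        · rw [hf] at hfj; cases hfj
          simp
        · have := h2 j hj b hfj
          simp only [Nat.succ_le_of_lt hj, if_true]
          exact List.mem_append_left _ this
      · simp
      · rw [Finset.sum_range_succ]
        simp only [le_refl, if_true, List.map_append, List.map_cons, List.map_nil]
        rw [pathLength_cons_append_singleton, ← h4, ← h3]
        congr 1
        · refine Finset.sum_congr rfl fun j hj => ?_
          rw [Finset.mem_range] at hj
          simp only [hj.le, Nat.succ_le_of_lt hj, if_true]
        · simp

theorem PLLoop.length_eq_cycleLength (γ : PLLoop) :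
    γ.length = cycleLength ((List.range γ.m).map fun j : ℕ => γ.v (j : ZMod γ.m)) := by
  rw [cycleLength_map_range (fun j : ℕ => γ.v (j : ZMod γ.m)) γ.m (by simp)]
  simp [PLLoop.length]

theorem PLLoop.length_nonneg (γ : PLLoop) : 0 ≤ γ.length :=
  Finset.sum_nonneg fun _ _ => dist_nonneg

namespace GateWord

variable {c : ℝ} {P : Set Pt} {n : ℕ} [NeZero n]

theorem Valid.exists_polygon {W : GateWord n} (hW : W.Valid c P) (D : List (Gate × Pt))
    (hD : D.map Prod.fst = W.letters) (hray : ∀ q ∈ D, q.2 ∈ q.1.ray c) (hne : D ≠ []) :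
    ∃ Y : ZMod n → Pt, (∀ i, Y i ∈ W.cell c P i) ∧
      PLLoop.length ⟨n, Nat.pos_of_neZero n, Y⟩ = cycleLength (D.map Prod.snd) := by
  have hn := Nat.pos_of_neZero n
  have hne' : D.map Prod.snd ≠ [] := by simpa using hne
  obtain ⟨Z, h0, h1, h2, h3, h4⟩ := exists_expansion (fun j : ℕ => W.gate (j : ZMod n))
    ((D.map Prod.snd).getLast hne') n D hD
  rw [← cycleLength_eq_pathLength_getLast] at h4
  rw [List.getLast_cons hne', ← h0] at h3
  have step : ∀ j < n, Z j ∈ slab c P (W.label (j : ℕ)) →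
      Z (j + 1) ∈ slab c P (W.label (j + 1 : ℕ)) := by
    intro j hj hz
    rw [Nat.cast_succ]
    rcases hg : W.gate (j : ZMod n) with _ | a
    · rw [h1 j hj hg, hW.label_add_one_of_none _ hg]; exact hz
    · rw [hW.label_add_one_of_some _ a hg]
      exact a.ray_subset_slab_tgt c P (hray _ (h2 j hj a hg))
  have start : Z 0 ∈ slab c P (W.label (0 : ℕ)) := by
    obtain ⟨j, hj, a, ha⟩ : ∃ j < n, ∃ a, W.gate (j : ZMod n) = some a := by
      by_contra! hno
      apply hne
      have : W.letters = [] := by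
        rw [letters, List.filterMap_eq_nil_iff]
        intro j hj
        exact Option.eq_none_iff_forall_ne_some.2 fun a => hno j (List.mem_range.1 hj) a
      simpa [this] using hD
    have : ∀ m, j + 1 ≤ m → m ≤ n → Z m ∈ slab c P (W.label (m : ℕ)) := by
      intro m hm
      induction m, hm using Nat.le_induction with
      | base =>
        intro _
        rw [Nat.cast_succ, hW.label_add_one_of_some _ a ha]
        exact a.ray_subset_slab_tgt c P (hray _ (h2 j hj a ha))
      | succ m hm ih => exact fun hmn => step m (by omega) (ih (by omega))
    have := this n (by omega) le_rfl
    rw [h3] at this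
    simpa using this
  have all : ∀ j ≤ n, Z j ∈ slab c P (W.label (j : ℕ)) := by
    intro j
    induction j with
    | zero => exact fun _ => start
    | succ j ih => exact fun hj => step j hj (ih (by omega))
  refine ⟨fun i => Z (i.val + 1), ?_, ?_⟩
  · intro i
    have hi := ZMod.val_lt i
    have hcast : ((i.val : ℕ) : ZMod n) = i := ZMod.natCast_zmod_val i
    simp only
    rcases hg : W.gate i with _ | a
    · rw [cell_none hg, h1 _ hi (by rwa [hcast])]
      simpa only [hcast] using all i.val hi.le
    · rw [cell_some hg]
      exact hray _ (h2 _ hi a (by rwa [hcast]))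
  · rw [PLLoop.length_eq_sum_add hn _ (-1), ← h4]
    have key : ∀ j ≤ n, Z ((-1 + (j : ℕ) : ZMod n).val + 1) = Z j := by
      intro j hj
      rcases j with _ | j
      · have : (-1 + (0 : ℕ) : ZMod n) = ((n - 1 : ℕ) : ZMod n) := by
          rw [Nat.cast_sub hn]; simp
        rw [this, ZMod.val_natCast, Nat.mod_eq_of_lt (by omega), Nat.sub_add_cancel hn, h3]
      · have : (-1 + (j + 1 : ℕ) : ZMod n) = (j : ℕ) := by push_cast; ring
        rw [this, ZMod.val_natCast, Nat.mod_eq_of_lt (by omega)]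
    refine Finset.sum_congr rfl fun j hj => ?_
    rw [Finset.mem_range] at hj
    rw [key j hj.le, key (j + 1) hj]

theorem map_snd_filterMap_sublist {α X : Type*} (g : ℕ → Option α) (x : ℕ → X) (l : List ℕ) :
    ((l.filterMap fun j => (g j).map fun a => (a, x j)).map Prod.snd).Sublist (l.map x) := by
  induction l with
  | nil => simp
  | cons j l ih =>
    rcases h : g j with _ | a
    · simpa [h] using ih.cons _
    · simpa [h] using ih.cons_cons (x j)

/-- A polygon that follows an itinerary can be shortened to a polygon that follows any conjugate
cyclically reduced itinerary. -/
theorem Valid.exists_length_le {W : GateWord n} (hW : W.Valid c P)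
    (hred : FreeGroup.IsCyclicallyReduced W.letters) {n' : ℕ} [NeZero n'] {W' : GateWord n'}
    (hconj : IsConj (FreeGroup.mk W.letters) (FreeGroup.mk W'.letters)) {X : ZMod n' → Pt}
    (hX : ∀ i, X i ∈ W'.cell c P i) :
    ∃ Y : ZMod n → Pt, (∀ i, Y i ∈ W.cell c P i) ∧
      PLLoop.length ⟨n, Nat.pos_of_neZero n, Y⟩ ≤ PLLoop.length ⟨n', Nat.pos_of_neZero n', X⟩ := by
  by_cases hnil : W.letters = []
  · have hg : ∀ i, W.gate i = none := by
      intro i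
      rw [letters, List.filterMap_eq_nil_iff] at hnil
      have := hnil i.val (List.mem_range.2 (ZMod.val_lt i))
      rwa [ZMod.natCast_zmod_val] at this
    have hl : ∀ j : ℕ, W.label (j : ZMod n) = W.label 0 := by
      intro j
      induction j with
      | zero => simp
      | succ j ih => rw [Nat.cast_succ, hW.label_add_one_of_none _ (hg _), ih]
    obtain ⟨z, hz⟩ := hW.openSlab_nonempty 0
    refine ⟨fun _ => z, fun i => ?_, ?_⟩
    · rw [cell_none (hg i), ← ZMod.natCast_zmod_val i, hl]
      exact openSlab_subset_slab c P _ hz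
    · refine le_trans (le_of_eq ?_) (PLLoop.length_nonneg _)
      simp [PLLoop.length]
  obtain ⟨v, hv, hsub⟩ := hred.exists_sublist hconj
  let D' : List (Gate × Pt) := (List.range n').filterMap fun j : ℕ =>
    (W'.gate (j : ZMod n')).map fun a => (a, X (j : ZMod n'))
  have hD' : D'.map Prod.fst = W'.letters := by
    simp only [D', letters, List.map_filterMap]
    congr 1
    funext j
    cases W'.gate (j : ZMod n') <;> rfl
  have hray : ∀ q ∈ D', q.2 ∈ q.1.ray c := by
    intro q hq
    obtain ⟨j, -, hj⟩ := List.mem_filterMap.1 hq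
    obtain ⟨a, ha, rfl⟩ := Option.map_eq_some_iff.1 hj
    have := hX (j : ZMod n')
    rwa [cell_some ha] at this
  rw [← hD'] at hsub
  obtain ⟨D₁, hD₁, rfl⟩ := List.sublist_map_iff.1 hsub
  obtain ⟨r, hr⟩ := hv
  have hmap : (D₁.rotate r).map Prod.fst = W.letters := by rw [List.map_rotate, hr]
  have hmem : ∀ q ∈ D₁.rotate r, q.2 ∈ q.1.ray c := fun q hq =>
    hray q (hD₁.subset (List.mem_rotate.1 hq))
  obtain ⟨Y, hY, hlen⟩ := hW.exists_polygon _ hmap hmem (by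
    rintro h
    rw [h] at hmap
    exact hnil hmap.symm)
  refine ⟨Y, hY, ?_⟩
  rw [hlen, List.map_rotate, cycleLength_rotate, PLLoop.length_eq_cycleLength]
  exact (cycleLength_le_of_sublist (hD₁.map Prod.snd)).trans
    (cycleLength_le_of_sublist (map_snd_filterMap_sublist _ _ _))

end GateWord

end

section

open Set Filter Topology

/-! ### Crossing words of sampled curves -/

open Classical in
/-- The gate crossed when moving between two nearby points. -/
def crossing (c : ℝ) (P : Set Pt) (x y : Pt) : Option Gate :=
  if h : ∃ p ∈ P, skewCoord c x < skewCoord c p ∧ skewCoord c p ≤ skewCoord c y then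
    some ((h.choose, decide (h.choose 1 < x 1)), true)
  else if h : ∃ p ∈ P, skewCoord c y < skewCoord c p ∧ skewCoord c p ≤ skewCoord c x then
    some ((h.choose, decide (h.choose 1 < x 1)), false)
  else none

/-- The gates crossed by a finite sequence of points. -/
def crossingWord (c : ℝ) (P : Set Pt) (x : ℕ → Pt) (N : ℕ) : List Gate :=
  (List.range N).filterMap fun j => crossing c P (x j) (x (j + 1))

/-- The crossing between two points as an element of the free group. -/
def crossingElt (c : ℝ) (P : Set Pt) (x y : Pt) : FreeGroup (Pt × Bool) :=
  FreeGroup.mk (crossing c P x y).toList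

/-- Both coordinates differ by less than `r`. -/
def NearBy (c r : ℝ) (x y : Pt) : Prop :=
  |skewCoord c x - skewCoord c y| < r ∧ |x 1 - y 1| < r

/-- `x` is at distance at least `2 * r` from all obstacles. -/
def FarFrom (c r : ℝ) (P : Set Pt) (x : Pt) : Prop :=
  ∀ p ∈ P, 2 * r ≤ |skewCoord c x - skewCoord c p| ∨ 2 * r ≤ |x 1 - p 1|

/-- The vertical lines through the obstacles are at distance at least `2 * r` from each other. -/
def GapAtLeast (c r : ℝ) (P : Set Pt) : Prop :=
  ∀ p ∈ P, ∀ q ∈ P, p ≠ q → 2 * r ≤ |skewCoord c p - skewCoord c q|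

variable {c r : ℝ} {P : Set Pt}

/-- Crossings are locally a coboundary. -/
theorem exists_crossingElt_eq (hgap : GapAtLeast c r P) {S : Set Pt}
    (hfar : ∀ x ∈ S, FarFrom c r P x) (hnear : ∀ x ∈ S, ∀ y ∈ S, NearBy c r x y) :
    ∃ h : Pt → FreeGroup (Pt × Bool), ∀ x ∈ S, ∀ y ∈ S, crossingElt c P x y = (h x)⁻¹ * h y := by
  classical
  by_cases hp : ∃ p ∈ P, ∃ x ∈ S, ∃ y ∈ S,
      skewCoord c x < skewCoord c p ∧ skewCoord c p ≤ skewCoord c y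
  · obtain ⟨p, hp, x, hx, y, hy, h1, h2⟩ := hp
    have hclose : ∀ z ∈ S, |skewCoord c z - skewCoord c p| < r := by
      intro z hz
      have h3 := abs_lt.1 (hnear z hz x hx).1
      have h4 := abs_lt.1 (hnear z hz y hy).1
      rw [abs_lt]
      constructor <;> linarith
    have hr : 0 < r := (abs_nonneg _).trans_lt (hclose x hx)
    have hside : ∀ z ∈ S, decide (p 1 < z 1) = decide (p 1 < x 1) := by
      intro z hz
      rw [decide_eq_decide]
      have e1 := (hfar z hz p hp).resolve_left (not_le.2 ((hclose z hz).trans (by linarith)))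
      have e2 := (hfar x hx p hp).resolve_left (not_le.2 ((hclose x hx).trans (by linarith)))
      have e3 := abs_lt.1 (hnear z hz x hx).2
      rcases le_abs.1 e1 with e1 | e1 <;> rcases le_abs.1 e2 with e2 | e2 <;>
        constructor <;> intro _ <;> linarith
    have huniq : ∀ y ∈ S, ∀ z ∈ S, ∀ q ∈ P, skewCoord c y < skewCoord c q →
        skewCoord c q ≤ skewCoord c z → q = p := by
      intro y hy z hz q hq e1 e2
      by_contra hne
      have e3 := abs_lt.1 (hclose y hy)
      have e4 := abs_lt.1 (hclose z hz)
      have := hgap q hq p hp hne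
      rcases le_abs.1 this with e5 | e5 <;> linarith
    refine ⟨fun z => if skewCoord c p ≤ skewCoord c z then
      FreeGroup.mk [((p, decide (p 1 < x 1)), true)] else 1, fun y hy z hz => ?_⟩
    unfold crossingElt crossing
    split_ifs with c1 c2
    · have e0 := c1.choose_spec
      have e := huniq y hy z hz _ e0.1 e0.2.1 e0.2.2
      rw [e] at e0
      simp only [e, hside y hy, if_pos e0.2.2, if_neg (not_le.2 e0.2.1), inv_one, one_mul,
        Option.toList_some]
    · have e0 := c2.choose_spec
      have e := huniq z hz y hy _ e0.1 e0.2.1 e0.2.2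
      rw [e] at e0
      simp only [e, hside y hy, if_pos e0.2.2, if_neg (not_le.2 e0.2.1), mul_one,
        FreeGroup.mk_singleton_inv, Option.toList_some, Bool.not_true]
    · have e1 : ¬ (skewCoord c y < skewCoord c p ∧ skewCoord c p ≤ skewCoord c z) :=
        fun h => c1 ⟨p, hp, h⟩
      have e2 : ¬ (skewCoord c z < skewCoord c p ∧ skewCoord c p ≤ skewCoord c y) :=
        fun h => c2 ⟨p, hp, h⟩
      have : skewCoord c p ≤ skewCoord c y ↔ skewCoord c p ≤ skewCoord c z := by
        rw [← not_lt, ← not_lt (b := skewCoord c p)]; grind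
      simp only [this, inv_mul_cancel, Option.toList_none, FreeGroup.one_eq_mk]
  · push Not at hp
    refine ⟨fun _ => 1, fun y hy z hz => ?_⟩
    have h1 : ¬ ∃ p ∈ P, skewCoord c y < skewCoord c p ∧ skewCoord c p ≤ skewCoord c z := by
      rintro ⟨p, h0, h1, h2⟩
      exact absurd h2 (not_le.2 (hp p h0 y hy z hz h1))
    have h2 : ¬ ∃ p ∈ P, skewCoord c z < skewCoord c p ∧ skewCoord c p ≤ skewCoord c y := by
      rintro ⟨p, h0, h1, h2⟩
      exact absurd h2 (not_le.2 (hp p h0 z hz y hy h1))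
    simp [crossingElt, crossing, h1, h2, FreeGroup.one_eq_mk]

theorem mk_crossingWord_succ (x : ℕ → Pt) (N : ℕ) :
    FreeGroup.mk (crossingWord c P x (N + 1)) =
      FreeGroup.mk (crossingWord c P x N) * crossingElt c P (x N) (x (N + 1)) := by
  rw [crossingWord, List.range_succ, List.filterMap_append, ← FreeGroup.mul_mk]
  congr 2

theorem isConj_crossingWord (hgap : GapAtLeast c r P) {x y : ℕ → Pt} {N : ℕ}
    (h : ∀ j < N, (∀ z ∈ ({x j, x (j + 1), y j, y (j + 1)} : Set Pt), FarFrom c r P z) ∧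
      ∀ z ∈ ({x j, x (j + 1), y j, y (j + 1)} : Set Pt),
        ∀ w ∈ ({x j, x (j + 1), y j, y (j + 1)} : Set Pt), NearBy c r z w)
    (hx : x N = x 0) (hy : y N = y 0) :
    IsConj (FreeGroup.mk (crossingWord c P x N)) (FreeGroup.mk (crossingWord c P y N)) := by
  have key : ∀ n ≤ N, FreeGroup.mk (crossingWord c P x n) * crossingElt c P (x n) (y n) =
      crossingElt c P (x 0) (y 0) * FreeGroup.mk (crossingWord c P y n) := by
    intro n hn
    induction n with
    | zero => simp [crossingWord, ← FreeGroup.one_eq_mk]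
    | succ n ih =>
      obtain ⟨g, hg⟩ := exists_crossingElt_eq hgap (h n hn).1 (h n hn).2
      rw [mk_crossingWord_succ, mk_crossingWord_succ, ← mul_assoc, ← ih (by omega), mul_assoc,
        mul_assoc, hg _ (by simp) _ (by simp), hg _ (by simp) _ (by simp),
        hg _ (by simp) _ (by simp), hg _ (by simp) _ (by simp)]
      group
  have := key N le_rfl
  rw [hx, hy] at this
  rw [isConj_iff]
  refine ⟨(crossingElt c P (x 0) (y 0))⁻¹, ?_⟩
  rw [inv_inv, mul_assoc, this]
  group

end

section

open Set Filter Topology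

variable {c r : ℝ} {P : Set Pt}

theorem nearBy_iff_dist {x y : Pt} :
    NearBy c r x y ↔ dist (skewCoord c x, x 1) (skewCoord c y, y 1) < r := by
  simp [NearBy, Prod.dist_eq, Real.dist_eq]

theorem exists_farFrom {X : Type*} [TopologicalSpace X] {K : Set X} (hK : IsCompact K)
    {f : X → Pt} (hf : Continuous f) (hfP : ∀ x ∈ K, f x ∉ P) (hP : P.Finite)
    (hc : InjOn (skewCoord c) P) :
    ∃ r > 0, GapAtLeast c r P ∧ ∀ x ∈ K, FarFrom c r P (f x) := by
  have hℓ := continuous_skewCoord c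
  obtain ⟨a, ha, haK⟩ := (hP.isCompact.prod hK).exists_forall_le' (a := (0 : ℝ))
    (f := fun z : Pt × X => max |skewCoord c (f z.2) - skewCoord c z.1| |f z.2 1 - z.1 1|)
    (by fun_prop) (by
      rintro ⟨p, x⟩ ⟨hp, hx⟩
      by_contra! h
      have h1 := (le_max_left _ _).trans h
      have h2 := (le_max_right _ _).trans h
      rw [abs_nonpos_iff, sub_eq_zero] at h1 h2
      exact hfP x hx (ext_skewCoord h1 h2 ▸ hp))
  obtain ⟨b, hb, hbP⟩ := hP.offDiag.isCompact.exists_forall_le' (a := (0 : ℝ))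
    (f := fun z : Pt × Pt => |skewCoord c z.1 - skewCoord c z.2|)
    (by fun_prop) (by
      rintro ⟨p, q⟩ ⟨hp, hq, hpq⟩
      exact abs_pos.2 (sub_ne_zero.2 fun h => hpq (hc hp hq h)))
  refine ⟨min a b / 2, by positivity, fun p hp q hq hpq => ?_, fun x hx p hp => ?_⟩
  · have := hbP (p, q) ⟨hp, hq, hpq⟩
    linarith [min_le_right a b]
  · have := haK (p, x) ⟨hp, hx⟩
    rw [mul_div_cancel₀ _ two_ne_zero]
    exact le_max_iff.1 ((min_le_left a b).trans this)

/-- A homotopy in the complement of `P` does not change the conjugacy class of the crossing word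
of sufficiently fine samples. -/
theorem exists_isConj_crossingWord {H : ℝ × ℝ → Pt} (hH : Continuous H)
    (hper : ∀ t s, H (t, s + 1) = H (t, s))
    {T : ℝ} (hT0 : 0 ≤ T) (hT1 : T ≤ 1) (hHP : ∀ t s, 0 ≤ t → t ≤ T → H (t, s) ∉ P)
    (hP : P.Finite) (hc : InjOn (skewCoord c) P) :
    ∃ N₀ : ℕ, ∀ N : ℕ, N₀ ≤ N → 0 < N →
      IsConj (FreeGroup.mk (crossingWord c P (fun j => H (0, j / N)) N))
        (FreeGroup.mk (crossingWord c P (fun j => H (T, j / N)) N)) := by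
  have hK : IsCompact (Icc (0 : ℝ) T ×ˢ Icc (0 : ℝ) 1) := isCompact_Icc.prod isCompact_Icc
  obtain ⟨r, hr, hgap, hfar⟩ := exists_farFrom hK hH
    (fun x hx => hHP x.1 x.2 hx.1.1 hx.1.2) hP hc
  have hℓ := continuous_skewCoord c
  have huc := hK.uniformContinuousOn_of_continuous
    (f := fun z => (skewCoord c (H z), H z 1)) (by fun_prop)
  obtain ⟨d, hd, hdK⟩ := Metric.uniformContinuousOn_iff.1 huc r hr
  obtain ⟨N₀, hN₀⟩ := exists_nat_one_div_lt hd
  refine ⟨N₀ + 1, fun N hN hN0 => ?_⟩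
  have hNd : 1 / (N : ℝ) < d := by
    refine lt_of_le_of_lt ?_ hN₀
    have : ((N₀ + 1 : ℕ) : ℝ) ≤ N := by exact_mod_cast hN
    push_cast at this
    gcongr
  have hN' : (0 : ℝ) < N := by exact_mod_cast hN0
  have key : ∀ i : ℕ, i ≤ N →
      IsConj (FreeGroup.mk (crossingWord c P (fun j => H (0, j / N)) N))
        (FreeGroup.mk (crossingWord c P (fun j => H (T * (i / N), j / N)) N)) := by
    intro i hi
    induction i with
    | zero =>
      rw [Nat.cast_zero, zero_div, mul_zero]
    | succ i ih =>
      refine (ih (by omega)).trans (isConj_crossingWord hgap (fun j hj => ?_) ?_ ?_)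
      · have hmem' : ∀ (i' j' : ℕ), i' ≤ N → j' ≤ N →
            (T * ((i' : ℝ) / N), (j' : ℝ) / N) ∈ Icc (0 : ℝ) T ×ˢ Icc (0 : ℝ) 1 := by
          intro i' j' hi' hj'
          have h1 : (i' : ℝ) / N ≤ 1 := div_le_one_of_le₀ (by exact_mod_cast hi') hN'.le
          have h2 : (j' : ℝ) / N ≤ 1 := div_le_one_of_le₀ (by exact_mod_cast hj') hN'.le
          exact ⟨⟨by positivity, mul_le_of_le_one_right hT0 h1⟩, by positivity, h2⟩
        have hdist : ∀ a b : ℕ, a ≤ b + 1 → b ≤ a + 1 → |(a : ℝ) / N - b / N| < d := by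
          intro a b h1 h2
          have h1 : (a : ℝ) ≤ b + 1 := by exact_mod_cast h1
          have h2 : (b : ℝ) ≤ a + 1 := by exact_mod_cast h2
          refine lt_of_le_of_lt ?_ hNd
          rw [← sub_div, abs_div, abs_of_pos hN']
          gcongr
          rw [abs_le]; constructor <;> linarith
        have hz : ∀ z ∈ ({H (T * ((i : ℕ) / N), (j : ℕ) / N),
            H (T * ((i : ℕ) / N), (j + 1 : ℕ) / N), H (T * ((i + 1 : ℕ) / N), (j : ℕ) / N),
            H (T * ((i + 1 : ℕ) / N), (j + 1 : ℕ) / N)} : Set Pt),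
            ∃ i' j' : ℕ, i ≤ i' ∧ i' ≤ i + 1 ∧ j ≤ j' ∧ j' ≤ j + 1 ∧
              z = H (T * ((i' : ℝ) / N), (j' : ℝ) / N) := by
          rintro z (rfl | rfl | rfl | rfl)
          · exact ⟨i, j, by omega, by omega, by omega, by omega, rfl⟩
          · exact ⟨i, j + 1, by omega, by omega, by omega, by omega, rfl⟩
          · exact ⟨i + 1, j, by omega, by omega, by omega, by omega, rfl⟩
          · exact ⟨i + 1, j + 1, by omega, by omega, by omega, by omega, rfl⟩
        constructor
        · intro z h
          obtain ⟨i', j', h1, h2, h3, h4, rfl⟩ := hz z h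
          exact hfar _ (hmem' i' j' (by omega) (by omega))
        · intro z h w h'
          obtain ⟨i', j', h1, h2, h3, h4, rfl⟩ := hz z h
          obtain ⟨i₂, j₂, h5, h6, h7, h8, rfl⟩ := hz w h'
          refine nearBy_iff_dist.2 (hdK _ (hmem' i' j' (by omega) (by omega)) _
            (hmem' i₂ j₂ (by omega) (by omega)) ?_)
          rw [Prod.dist_eq, Real.dist_eq, Real.dist_eq, ← mul_sub, abs_mul, abs_of_nonneg hT0]
          refine max_lt (lt_of_le_of_lt ?_ (hdist i' i₂ (by omega) (by omega)))
            (hdist j' j₂ (by omega) (by omega))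
          exact mul_le_of_le_one_left (abs_nonneg _) hT1
      all_goals
        simp only [div_self hN'.ne', Nat.cast_zero, zero_div]
        conv_lhs => rw [← zero_add (1 : ℝ)]
        exact hper _ _
  have := key N le_rfl
  rwa [div_self hN'.ne', mul_one] at this

end

section

open Set Filter Topology

/-! ### Snapping to the vertical lines through the obstacles -/

open Classical in
/-- Move the points at distance less than `η` from `F` to `F`. -/
def snap (F : Set ℝ) (η u : ℝ) : ℝ := if h : ∃ f ∈ F, |u - f| < η then h.choose else u

section Snap

variable {F : Set ℝ} {η : ℝ}

theorem snap_eq_self {u : ℝ} (h : ∀ f ∈ F, η ≤ |u - f|) : snap F η u = u := by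
  unfold snap
  rw [dif_neg]
  rintro ⟨f, hf, h'⟩
  exact absurd (h f hf) (not_le.2 h')

theorem snap_eq (hF : ∀ f ∈ F, ∀ g ∈ F, f ≠ g → 2 * η ≤ |f - g|) {u f : ℝ} (hf : f ∈ F)
    (h : |u - f| < η) : snap F η u = f := by
  have h' : ∃ f ∈ F, |u - f| < η := ⟨f, hf, h⟩
  unfold snap
  rw [dif_pos h']
  by_contra hne
  have h1 := abs_lt.1 h'.choose_spec.2
  have h2 := abs_lt.1 h
  rcases le_abs.1 (hF _ h'.choose_spec.1 _ hf hne) with h3 | h3 <;> linarith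

theorem abs_snap_sub_le (hη : 0 ≤ η) (u : ℝ) : |snap F η u - u| ≤ η := by
  unfold snap
  split_ifs with h
  · rw [abs_sub_comm]; exact h.choose_spec.2.le
  · simpa using hη

theorem monotone_snap (hF : ∀ f ∈ F, ∀ g ∈ F, f ≠ g → 2 * η ≤ |f - g|) :
    Monotone (snap F η) := by
  intro u v huv
  by_cases hu : ∃ f ∈ F, |u - f| < η
  · obtain ⟨f, hf, hu⟩ := hu
    rw [snap_eq hF hf hu]
    have h1 := abs_lt.1 hu
    by_cases hv : ∃ f ∈ F, |v - f| < η
    · obtain ⟨g, hg, hv⟩ := hv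
      rw [snap_eq hF hg hv]
      have h2 := abs_lt.1 hv
      rcases eq_or_ne f g with rfl | hne
      · rfl
      · rcases le_abs.1 (hF f hf g hg hne) with h3 | h3 <;> linarith
    · push Not at hv
      rw [snap_eq_self hv]
      rcases le_abs.1 (hv f hf) with h3 | h3 <;> linarith
  · push Not at hu
    rw [snap_eq_self hu]
    by_cases hv : ∃ f ∈ F, |v - f| < η
    · obtain ⟨g, hg, hv⟩ := hv
      rw [snap_eq hF hg hv]
      have h2 := abs_lt.1 hv
      rcases le_abs.1 (hu g hg) with h3 | h3 <;> linarith
    · push Not at hv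
      rwa [snap_eq_self hv]

theorem snap_eq_of_mem (hη : 0 < η) (hF : ∀ f ∈ F, ∀ g ∈ F, f ≠ g → 2 * η ≤ |f - g|) {f : ℝ}
    (hf : f ∈ F) : snap F η f = f :=
  snap_eq hF hf (by simpa using hη)

end Snap

/-- `Z` is obtained from `z` by a small move that pushes it onto any vertical line of an obstacle
at distance less than `η`. -/
def Snapped (c η : ℝ) (P : Set Pt) (z Z : Pt) : Prop :=
  ∀ p ∈ P, (skewCoord c p + η ≤ skewCoord c z → skewCoord c p ≤ skewCoord c Z) ∧
    (skewCoord c z ≤ skewCoord c p - η → skewCoord c Z ≤ skewCoord c p) ∧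
    (|skewCoord c z - skewCoord c p| < η → skewCoord c Z = skewCoord c p ∧
      (p 1 - η < z 1 → p 1 ≤ Z 1) ∧ (z 1 < p 1 + η → Z 1 ≤ p 1))

variable {c : ℝ} {P : Set Pt}

/-- The points of a segment can be snapped monotonically. -/
theorem eventually_exists_snapped_segment (hP : P.Finite) {a b : Pt}
    (hc : InjOn (skewCoord c) (P ∪ {a, b})) {ε : ℝ} (hε : 0 < ε) :
    ∀ᶠ η in 𝓝[>] (0 : ℝ), ∃ ϑ : ℝ → ℝ, Monotone ϑ ∧ ϑ 0 = 0 ∧ ϑ 1 = 1 ∧ ∀ u,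
      dist ((1 - u) • a + u • b) ((1 - ϑ u) • a + ϑ u • b) ≤ ε ∧
      Snapped c η P ((1 - u) • a + u • b) ((1 - ϑ u) • a + ϑ u • b) := by
  have hlt : ∀ {C : ℝ}, 0 < C → ∀ᶠ η in 𝓝[>] (0 : ℝ), η < C := fun h =>
    mem_of_superset (Ioo_mem_nhdsGT h) fun _ hη => hη.2
  have hpos : ∀ᶠ η in 𝓝[>] (0 : ℝ), 0 < η := self_mem_nhdsWithin
  have hfin : (P ∪ {a, b}).Finite := hP.union (by simp)
  have hgap : ∀ᶠ η in 𝓝[>] (0 : ℝ), ∀ p ∈ P ∪ {a, b}, ∀ q ∈ P ∪ {a, b}, p ≠ q →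
      2 * η < |skewCoord c p - skewCoord c q| := by
    rw [eventually_all_finite hfin]; intro p hp
    rw [eventually_all_finite hfin]; intro q hq
    rcases eq_or_ne p q with rfl | hne
    · simp
    · have h := abs_pos.2 (sub_ne_zero.2 fun h => hne (hc hp hq h))
      filter_upwards [hlt (half_pos h)] with η hη _
      linarith
  rcases eq_or_ne a b with rfl | hab
  · filter_upwards [hgap, hpos] with η hη hη0
    refine ⟨id, monotone_id, rfl, rfl, fun u => ?_⟩
    simp only [id, ← add_smul, sub_add_cancel, one_smul, dist_self]
    refine ⟨hε.le, fun p hp => ⟨fun h => by linarith, fun h => by linarith, fun h => ?_⟩⟩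
    obtain rfl : a = p := by
      by_contra hne
      linarith [hη a (by simp) p (by simp [hp]) hne]
    simp
  have hℓ : skewCoord c b - skewCoord c a ≠ 0 := by
    rw [sub_ne_zero]; exact fun h => hab (hc (by simp) (by simp) h.symm)
  set D := skewCoord c b - skewCoord c a with hD
  set κ := (b 1 - a 1) / D with hκ
  have hside : ∀ᶠ η in 𝓝[>] (0 : ℝ), ∀ p ∈ P,
      a 1 + κ * (skewCoord c p - skewCoord c a) = p 1 ∨
      (|κ| + 1) * η < |a 1 + κ * (skewCoord c p - skewCoord c a) - p 1| := by
    rw [eventually_all_finite hP]; intro p hp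
    by_cases h : a 1 + κ * (skewCoord c p - skewCoord c a) = p 1
    · exact Eventually.of_forall fun _ => Or.inl h
    · have h := abs_pos.2 (sub_ne_zero.2 h)
      have h1 : 0 < |κ| + 1 := by positivity
      filter_upwards [hlt (div_pos h h1)] with η hη
      right
      rwa [lt_div_iff₀' h1] at hη
  have hdist : ∀ᶠ η in 𝓝[>] (0 : ℝ), η / |D| * dist a b ≤ ε := by
    have h1 : 0 < |D| := abs_pos.2 hℓ
    have h2 : 0 < dist a b := dist_pos.2 hab
    filter_upwards [hlt (div_pos (mul_pos hε h1) h2)] with η hη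
    rw [lt_div_iff₀ h2] at hη
    rw [div_mul_eq_mul_div, div_le_iff₀ h1]
    exact hη.le
  filter_upwards [hgap, hside, hdist, hpos] with η hgap hside hdist hη0
  set F := skewCoord c '' P with hFdef
  have hF : ∀ f ∈ F, ∀ g ∈ F, f ≠ g → 2 * η ≤ |f - g| := by
    rintro _ ⟨p, hp, rfl⟩ _ ⟨q, hq, rfl⟩ hne
    exact (hgap p (by simp [hp]) q (by simp [hq]) fun h => hne (by rw [h])).le
  have hfix : ∀ q ∈ P ∪ {a, b}, snap F η (skewCoord c q) = skewCoord c q := by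
    intro q hq
    by_cases hqP : q ∈ P
    · exact snap_eq_of_mem hη0 hF ⟨q, hqP, rfl⟩
    · refine snap_eq_self ?_
      rintro _ ⟨p, hp, rfl⟩
      have := hgap q hq p (by simp [hp]) fun h => hqP (h ▸ hp)
      linarith
  let L : ℝ → ℝ := fun u => skewCoord c a + u * D
  have hL : ∀ u, skewCoord c ((1 - u) • a + u • b) = L u := fun u => by
    rw [skewCoord_combo]; simp only [L, hD]; ring
  let ϑ : ℝ → ℝ := fun u => (snap F η (L u) - skewCoord c a) / D
  have hϑ : ∀ u, L (ϑ u) = snap F η (L u) := fun u => by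
    simp only [L, ϑ]; rw [div_mul_cancel₀ _ hℓ]; ring
  have h1 : ∀ u, ((1 - u) • a + u • b) 1 = a 1 + κ * (L u - skewCoord c a) := fun u => by
    rw [apply_one_combo]; simp only [L, hκ]
    field_simp
    ring
  refine ⟨ϑ, ?_, ?_, ?_, fun u => ⟨?_, fun p hp => ?_⟩⟩
  · intro u v huv
    have hm := monotone_snap hF
    rcases lt_or_gt_of_ne hℓ with h | h
    · refine div_le_div_of_nonpos_of_le h.le (sub_le_sub_right (hm ?_) _)
      simp only [L]; nlinarith
    · refine div_le_div_of_nonneg_right (sub_le_sub_right (hm ?_) _) h.le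
      simp only [L]; nlinarith
  · simp [ϑ, L, hfix a (by simp)]
  · have : L 1 = skewCoord c b := by simp [L, hD]
    simp only [ϑ, this, hfix b (by simp)]
    exact div_self hℓ
  · refine le_trans ?_ hdist
    have e : (1 - u) • a + u • b - ((1 - ϑ u) • a + ϑ u • b) = (ϑ u - u) • (a - b) := by module
    rw [dist_eq_norm, e, norm_smul, ← dist_eq_norm a, Real.norm_eq_abs]
    gcongr
    rw [le_div_iff₀ (abs_pos.2 hℓ), ← abs_mul]
    have : (ϑ u - u) * D = snap F η (L u) - L u := by rw [← hϑ]; simp only [L]; ring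
    rw [this]
    exact abs_snap_sub_le hη0.le _
  · have hpF : skewCoord c p ∈ F := ⟨p, hp, rfl⟩
    have hps := snap_eq_of_mem hη0 hF hpF
    rw [hL, hL, hϑ, h1, h1, hϑ]
    refine ⟨fun h => ?_, fun h => ?_, fun h => ?_⟩
    · rw [← hps]; exact monotone_snap hF (by linarith)
    · rw [← hps]; exact monotone_snap hF (by linarith)
    rw [snap_eq hF hpF h]
    refine ⟨rfl, ?_⟩
    have h2 : |κ * (L u - skewCoord c p)| ≤ |κ| * η := by
      rw [abs_mul]; gcongr
    rw [abs_le] at h2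
    rcases hside p hp with h3 | h3
    · rw [h3]; simp
    · rcases lt_abs.1 h3 with h3 | h3
      · exact ⟨fun _ => by nlinarith [abs_nonneg κ], fun _ => by nlinarith [abs_nonneg κ]⟩
      · exact ⟨fun _ => by nlinarith [abs_nonneg κ], fun _ => by nlinarith [abs_nonneg κ]⟩

end

section

open Set Filter Topology

variable {c : ℝ} {P : Set Pt}

/-- The vertices and the points of a polygonal loop can be snapped, without changing its length. -/
theorem eventually_exists_snapped_loop (hP : P.Finite) (δ : PLLoop)
    (hc : InjOn (skewCoord c) (P ∪ range δ.v)) {ε : ℝ} (hε : 0 < ε) :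
    ∀ᶠ η in 𝓝[>] (0 : ℝ), ∃ Z : ℝ → Pt, (∀ s, Z (s + 1) = Z s) ∧
      (∀ s, dist (δ.toFun s) (Z s) ≤ ε ∧ Snapped c η P (δ.toFun s) (Z s)) ∧
      ∀ L : ℕ, 0 < L → ∑ j ∈ Finset.range (δ.m * L),
        dist (Z (j / (δ.m * L : ℕ))) (Z ((j + 1 : ℕ) / (δ.m * L : ℕ))) = δ.length := by
  have : NeZero δ.m := ⟨δ.m_pos.ne'⟩
  have hm : (0 : ℝ) < δ.m := by exact_mod_cast δ.m_pos
  have key : ∀ i : ZMod δ.m, ∀ᶠ η in 𝓝[>] (0 : ℝ), _ := fun i =>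
    eventually_exists_snapped_segment hP (a := δ.v i) (b := δ.v (i + 1))
      (hc.mono (union_subset_union_right _ (by simp [insert_subset_iff]))) hε
  filter_upwards [eventually_all.2 key] with η hη
  choose ϑ hmono hϑ0 hϑ1 hϑ using hη
  let Z : ℝ → Pt := fun s => (1 - ϑ (⌊s * δ.m⌋ : ℤ) (Int.fract (s * δ.m))) • δ.v (⌊s * δ.m⌋ : ℤ) +
    ϑ (⌊s * δ.m⌋ : ℤ) (Int.fract (s * δ.m)) • δ.v ((⌊s * δ.m⌋ : ℤ) + 1)
  have hZ : ∀ (k : ℤ) (s : ℝ), (k : ℝ) ≤ s * δ.m → s * δ.m ≤ k + 1 →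
      Z s = (1 - ϑ k (s * δ.m - k)) • δ.v k + ϑ k (s * δ.m - k) • δ.v (k + 1) := by
    intro k s h1 h2
    rcases h2.eq_or_lt with h | h
    · have : ⌊(k : ℝ) + 1⌋ = k + 1 := by simp
      simp [Z, h, this, hϑ0, hϑ1]
    · have : ⌊s * δ.m⌋ = k := Int.floor_eq_iff.2 ⟨h1, h⟩
      have hf : Int.fract (s * δ.m) = s * δ.m - k := by rw [Int.fract, this]
      simp only [Z, hf, this]
  refine ⟨Z, fun s => ?_, fun s => ?_, fun L hL => ?_⟩
  · have h1 : ⌊(s + 1) * δ.m⌋ = ⌊s * δ.m⌋ + δ.m := by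
      rw [add_mul, one_mul, Int.floor_add_natCast]
    have h2 : Int.fract ((s + 1) * δ.m) = Int.fract (s * δ.m) := by
      rw [add_mul, one_mul, Int.fract_add_natCast]
    simp [Z, h1, h2]
  · have h1 := Int.floor_le (s * δ.m)
    have h2 := (Int.lt_floor_add_one (s * δ.m)).le
    rw [hZ _ s h1 h2, δ.toFun_of_mem_Icc _ h1 h2]
    exact hϑ _ _
  · have hL' : (0 : ℝ) < L := by exact_mod_cast hL
    have hval : ∀ (k i : ℕ), i ≤ L → Z ((k * L + i : ℕ) / (δ.m * L : ℕ)) =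
        (1 - ϑ k (i / L)) • δ.v k + ϑ k (i / L) • δ.v (k + 1) := by
      intro k i hi
      have hi' : (i : ℝ) / L ≤ 1 := div_le_one_of_le₀ (by exact_mod_cast hi) hL'.le
      have e : ((k * L + i : ℕ) / (δ.m * L : ℕ) : ℝ) * δ.m = k + i / L := by
        push_cast; field_simp
      have := hZ k ((k * L + i : ℕ) / (δ.m * L : ℕ)) (by rw [e]; push_cast; simp; positivity)
        (by rw [e]; push_cast; linarith)
      rw [this, e]
      simp
    have hsum : ∀ k : ℕ, ∑ j ∈ Finset.range (k * L),
        dist (Z (j / (δ.m * L : ℕ))) (Z ((j + 1 : ℕ) / (δ.m * L : ℕ))) =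
        ∑ i ∈ Finset.range k, dist (δ.v i) (δ.v (i + 1)) := by
      intro k
      induction k with
      | zero => simp
      | succ k ih =>
        rw [add_mul, one_mul, Finset.sum_range_add, ih, Finset.sum_range_succ]
        congr 1
        have hd : ∀ i ∈ Finset.range L, dist (Z ((k * L + i : ℕ) / (δ.m * L : ℕ)))
            (Z ((k * L + i + 1 : ℕ) / (δ.m * L : ℕ))) =
            (ϑ k ((i + 1 : ℕ) / L) - ϑ k ((i : ℕ) / L)) * dist (δ.v k) (δ.v (k + 1)) := by
          intro i hi
          have hi := Finset.mem_range.1 hi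
          rw [hval k i hi.le, add_assoc, hval k (i + 1) hi]
          have h0 : ϑ k (i / L) ≤ ϑ k ((i + 1 : ℕ) / L) :=
            hmono k (by gcongr; exact i.le_succ)
          set a := ϑ k (i / L)
          set b := ϑ k ((i + 1 : ℕ) / L)
          have e : (1 - a) • δ.v k + a • δ.v (k + 1) - ((1 - b) • δ.v k + b • δ.v (k + 1)) =
            (b - a) • (δ.v k - δ.v (k + 1)) := by module
          rw [dist_eq_norm, e, norm_smul, ← dist_eq_norm (δ.v k),
            Real.norm_of_nonneg (sub_nonneg.2 h0)]
        rw [Finset.sum_congr rfl hd, ← Finset.sum_mul,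
          Finset.sum_range_sub (fun i : ℕ => ϑ k ((i : ℕ) / L)), div_self hL'.ne']
        simp [hϑ0, hϑ1]
    rw [hsum]
    rfl

end

section

open Set Filter Topology

/-! ### Itineraries read off from sampled curves -/

theorem uniformContinuous_of_periodic {E : Type*} [PseudoMetricSpace E] {f : ℝ → E}
    (hf : Continuous f) (hper : Function.Periodic f 1) : UniformContinuous f := by
  rw [Metric.uniformContinuous_iff]
  intro ε hε
  obtain ⟨d, hd, h⟩ := Metric.uniformContinuousOn_iff.1
    ((isCompact_Icc (a := (-1 : ℝ)) (b := 2)).uniformContinuousOn_of_continuous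
      hf.continuousOn) ε hε
  refine ⟨min d 1, by positivity, fun {a b} hab => ?_⟩
  have h1 := Int.floor_le a
  have h2 := Int.lt_floor_add_one a
  have hab1 := hab.trans_le (min_le_right _ _)
  rw [Real.dist_eq, abs_lt] at hab1
  have := h (a - ⌊a⌋) ⟨by linarith, by linarith⟩ (b - ⌊a⌋) ⟨by linarith, by linarith⟩
    (by rw [dist_sub_right]; exact hab.trans_le (min_le_left _ _))
  have e : ∀ x, f (x - ⌊a⌋) = f x := fun x => by simpa using hper.sub_int_mul_eq (x := x) ⌊a⌋
  rwa [e, e] at this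

variable {c r : ℝ} {P : Set Pt}

theorem FarFrom.mono {r' : ℝ} (hr : r' ≤ r) {x : Pt} (h : FarFrom c r P x) : FarFrom c r' P x :=
  fun p hp => (h p hp).imp (by intro h; linarith) (by intro h; linarith)

theorem GapAtLeast.mono {r' : ℝ} (hr : r' ≤ r) (h : GapAtLeast c r P) : GapAtLeast c r' P :=
  fun p hp q hq hpq => by linarith [h p hp q hq hpq]

theorem NearBy.refl (hr : 0 < r) (x : Pt) : NearBy c r x x := by
  simp [NearBy, hr]

theorem NearBy.combo {x y z : Pt} {t : ℝ} (hy : NearBy c r x y) (hz : NearBy c r x z)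
    (h0 : 0 ≤ t) (h1 : t ≤ 1) : NearBy c r x ((1 - t) • y + t • z) := by
  have key : ∀ a b d : ℝ, |a - b| < r → |a - d| < r → |a - ((1 - t) * b + t * d)| < r := by
    intro a b d h h'
    rw [abs_lt] at *
    rcases h0.eq_or_lt with rfl | h0
    · simpa using h
    · constructor <;> nlinarith
  refine ⟨?_, ?_⟩
  · rw [skewCoord_combo]; exact key _ _ _ hy.1 hz.1
  · rw [apply_one_combo]; exact key _ _ _ hy.2 hz.2

theorem FarFrom.notMem_of_nearBy {x y : Pt} (hr : 0 < r) (h : FarFrom c r P x)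
    (hy : NearBy c r x y) : y ∉ P := by
  intro hyP
  rcases h y hyP with h | h
  · linarith [hy.1]
  · linarith [hy.2]

/-- The label of the slab of a point; points on the lines are counted to their right. -/
def labelAt (c : ℝ) (P : Set Pt) (x : Pt) : Set Pt := {q ∈ P | skewCoord c q ≤ skewCoord c x}

theorem openSlab_labelAt_nonempty (hP : P.Finite) (x : Pt) :
    (openSlab c P (labelAt c P x)).Nonempty := by
  have h : ∀ᶠ u in 𝓝[>] skewCoord c x, skewCoord c x < u ∧
      ∀ q ∈ P, skewCoord c x < skewCoord c q → u < skewCoord c q := by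
    refine (eventually_mem_nhdsWithin).and ?_
    rw [eventually_all_finite hP]
    intro q hq
    by_cases h : skewCoord c x < skewCoord c q
    · filter_upwards [Ioo_mem_nhdsGT h] with u hu _ using hu.2
    · exact Eventually.of_forall fun u h' => absurd h' h
  obtain ⟨u, hu, hq⟩ := h.exists
  refine ⟨skewPoint c u 0, fun q hqP => ?_⟩
  rw [skewCoord_skewPoint]
  exact ⟨fun h => h.2.trans_lt hu, fun h => hq q hqP (not_le.1 fun h' => h ⟨hqP, h'⟩)⟩

theorem labelAt_eq_of_crossing_eq_none {x y : Pt} (h : crossing c P x y = none) :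
    labelAt c P x = labelAt c P y := by
  unfold crossing at h
  split_ifs at h with h1 h2
  ext q
  refine and_congr_right fun hq => ?_
  constructor <;> intro h <;> by_contra! h'
  · exact h2 ⟨q, hq, h', h⟩
  · exact h1 ⟨q, hq, h', h⟩

/-- The properties of a crossing between nearby points. -/
theorem crossing_spec (hgap : GapAtLeast c r P) {x y : Pt} (hxy : NearBy c r x y) {a : Gate}
    (h : crossing c P x y = some a) :
    a.1.1 ∈ P ∧ labelAt c P x = a.src c P ∧ labelAt c P y = a.tgt c P ∧
      |skewCoord c x - skewCoord c a.1.1| < r ∧ skewCoord c x ≠ skewCoord c y ∧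
      (0 ≤ (skewCoord c a.1.1 - skewCoord c x) / (skewCoord c y - skewCoord c x) ∧
       (skewCoord c a.1.1 - skewCoord c x) / (skewCoord c y - skewCoord c x) ≤ 1) ∧
      a.1.2 = decide (a.1.1 1 < x 1) := by
  have hn := abs_lt.1 hxy.1
  have hr : 0 < r := (abs_nonneg _).trans_lt hxy.1
  have key : ∀ x y p : Pt, p ∈ P → skewCoord c x < skewCoord c p → skewCoord c p ≤ skewCoord c y →
      skewCoord c y < skewCoord c x + r →
      labelAt c P x = {q ∈ P | skewCoord c q < skewCoord c p} ∧
      labelAt c P y = {q ∈ P | skewCoord c q ≤ skewCoord c p} := by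
    intro x y p hp h1 h2 h3
    constructor
    · ext q
      refine and_congr_right fun hq => ⟨fun h => h.trans_lt h1, fun h => ?_⟩
      rcases le_abs.1 (hgap p hp q hq fun e => by simp [e] at h) with h4 | h4 <;> linarith
    · ext q
      refine and_congr_right fun hq => ⟨fun h => ?_, fun h => h.trans h2⟩
      by_contra! h'
      rcases le_abs.1 (hgap p hp q hq fun e => by simp [e] at h') with h4 | h4 <;> linarith
  unfold crossing at h
  split_ifs at h with h1 h2
  · obtain ⟨hp, g1, g2⟩ := h1.choose_spec
    set p := h1.choose
    obtain rfl := Option.some_injective _ h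
    obtain ⟨k1, k2⟩ := key x y p hp g1 g2 (by linarith)
    have h3 : 0 < skewCoord c y - skewCoord c x := by linarith
    refine ⟨hp, by simp [k1, Gate.src], by simp [k2, Gate.tgt, Gate.rev, Gate.src], ?_, ?_,
      ⟨?_, ?_⟩,
      rfl⟩
    · rw [abs_lt]; constructor <;> linarith
    · linarith
    · exact div_nonneg (by linarith) h3.le
    · rw [div_le_one h3]; linarith
  · obtain ⟨hp, g1, g2⟩ := h2.choose_spec
    set p := h2.choose
    obtain rfl := Option.some_injective _ h
    obtain ⟨k1, k2⟩ := key y x p hp g1 g2 (by linarith)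
    have h3 : skewCoord c y - skewCoord c x < 0 := by linarith
    refine ⟨hp, by simp [k2, Gate.src], by simp [k1, Gate.tgt, Gate.rev, Gate.src], ?_, ?_,
      ⟨?_, ?_⟩,
      rfl⟩
    · rw [abs_lt]; constructor <;> linarith
    · linarith
    · exact div_nonneg_of_nonpos (by linarith) h3.le
    · rw [div_le_one_of_neg h3]; linarith

/-- The point where the segment between two nearby points crosses its gate. -/
theorem exists_mem_ray_of_crossing (hgap : GapAtLeast c r P) {x y : Pt} (hfar : FarFrom c r P x)
    (hxy : NearBy c r x y) :
    ∃ z, NearBy c r x z ∧ NearBy c r y z ∧ (crossing c P x y = none → z = x) ∧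
      ∀ a, crossing c P x y = some a → z ∈ a.ray c := by
  have hr : 0 < r := (abs_nonneg _).trans_lt hxy.1
  have hyx : NearBy c r y x := by
    rw [NearBy, abs_sub_comm, abs_sub_comm (y 1)]; exact hxy
  rcases h : crossing c P x y with _ | a
  · exact ⟨x, .refl hr x, hyx, fun _ => rfl, by simp⟩
  obtain ⟨hp, -, -, hclose, hne, ⟨h0, h1⟩, hside⟩ := crossing_spec hgap hxy h
  set u := (skewCoord c a.1.1 - skewCoord c x) / (skewCoord c y - skewCoord c x) with hu
  have hz := (NearBy.refl hr x).combo hxy h0 h1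
  refine ⟨(1 - u) • x + u • y, hz, hyx.combo (.refl hr y) h0 h1, by simp, ?_⟩
  rintro _ ⟨⟩
  refine ⟨?_, ?_⟩
  · rw [skewCoord_combo, hu]
    field_simp [sub_ne_zero.2 hne.symm]
    ring
  · have h2 := abs_lt.1 hz.2
    have h3 := (hfar _ hp).resolve_left (by linarith)
    rw [hside]
    rcases le_abs.1 h3 with h3 | h3
    · rw [if_pos (by simp; linarith)]; linarith
    · rw [if_neg (by simp; linarith)]; linarith

/-- Interleave two sequences of period `N` to a cyclic sequence of length `2 * N`. -/
def interleave {α : Type*} (a b : ℕ → α) (N : ℕ) (i : ZMod (2 * N)) : α :=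
  if i.val % 2 = 0 then a (i.val / 2) else b (i.val / 2)

section Interleave

variable {α : Type*} {a b : ℕ → α} {N : ℕ}

theorem interleave_two_mul (ha : Function.Periodic a N) (j : ℕ) :
    interleave a b N ((2 * j : ℕ) : ZMod (2 * N)) = a j := by
  have : (2 * j) % (2 * N) = 2 * (j % N) := Nat.mul_mod_mul_left _ _ _
  simp [interleave, ZMod.val_natCast, this, -Nat.cast_mul, ha.map_mod_nat]

theorem interleave_two_mul_add_one (hN : 0 < N) (hb : Function.Periodic b N) (j : ℕ) :
    interleave a b N ((2 * j + 1 : ℕ) : ZMod (2 * N)) = b j := by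
  have : (2 * j + 1) % (2 * N) = 2 * (j % N) + 1 := by
    have h := Nat.mod_lt j hN
    conv_lhs => rw [← Nat.div_add_mod j N]
    have e : 2 * (N * (j / N) + j % N) + 1 = (2 * (j % N) + 1) + 2 * N * (j / N) := by ring
    rw [e, Nat.add_mul_mod_self_left, Nat.mod_eq_of_lt (by omega)]
  have e : (2 * (j % N) + 1) / 2 = j % N := by omega
  simp [interleave, ZMod.val_natCast, this, -Nat.cast_mul, -Nat.cast_add, e,
    hb.map_mod_nat, Nat.add_mod]

/-- Every index is even or odd. -/
theorem forall_zmod_two_mul {N : ℕ} [NeZero N] {p : ZMod (2 * N) → Prop}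
    (h0 : ∀ j : ℕ, p ((2 * j : ℕ) : ZMod (2 * N)))
    (h1 : ∀ j : ℕ, p ((2 * j + 1 : ℕ) : ZMod (2 * N)))
    (i : ZMod (2 * N)) : p i := by
  rw [← ZMod.natCast_zmod_val i]
  rcases Nat.even_or_odd' i.val with ⟨j, h | h⟩ <;> rw [h]
  · exact h0 j
  · exact h1 j

end Interleave

/-- The itinerary of a sampled curve. -/
def sampledWord (c : ℝ) (P : Set Pt) (x : ℕ → Pt) (N : ℕ) : GateWord (2 * N) where
  gate := interleave (fun _ => none) (fun j => crossing c P (x j) (x (j + 1))) N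
  label := interleave (fun j => labelAt c P (x j)) (fun j => labelAt c P (x j)) N

section SampledWord

variable {x : ℕ → Pt} {N : ℕ}

theorem sampledWord_gate_two_mul (j : ℕ) :
    (sampledWord c P x N).gate ((2 * j : ℕ) : ZMod (2 * N)) = none := by
  dsimp only [sampledWord]
  exact interleave_two_mul (a := fun _ => none) (N := N) (fun _ => rfl) j

theorem sampledWord_gate_two_mul_add_one (hN : 0 < N) (hx : Function.Periodic x N) (j : ℕ) :
    (sampledWord c P x N).gate ((2 * j + 1 : ℕ) : ZMod (2 * N)) =
      crossing c P (x j) (x (j + 1)) := by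
  dsimp only [sampledWord]
  exact interleave_two_mul_add_one (b := fun j => crossing c P (x j) (x (j + 1))) hN
    (fun j => by
      have := hx (j + 1)
      simp only [hx j, add_right_comm j N 1, this]) j

theorem sampledWord_label_two_mul (hx : Function.Periodic x N) (j : ℕ) :
    (sampledWord c P x N).label ((2 * j : ℕ) : ZMod (2 * N)) = labelAt c P (x j) := by
  dsimp only [sampledWord]
  exact interleave_two_mul (a := fun j => labelAt c P (x j)) (N := N)
    (fun j => by simp only [hx j]) j

theorem sampledWord_label_two_mul_add_one (hN : 0 < N) (hx : Function.Periodic x N) (j : ℕ) :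
    (sampledWord c P x N).label ((2 * j + 1 : ℕ) : ZMod (2 * N)) = labelAt c P (x j) := by
  dsimp only [sampledWord]
  exact interleave_two_mul_add_one (b := fun j => labelAt c P (x j)) hN
    (fun j => by simp only [hx j]) j

theorem sampledWord_letters (hN : 0 < N) (hx : Function.Periodic x N) :
    (sampledWord c P x N).letters = crossingWord c P x N := by
  have : ∀ n : ℕ, (List.range (2 * n)).filterMap
      (fun j : ℕ => (sampledWord c P x N).gate (j : ZMod (2 * N))) = crossingWord c P x n := by
    intro n
    induction n with
    | zero => rfl
    | succ n ih =>
      rw [mul_add, mul_one, List.range_succ, List.range_succ, List.filterMap_append,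
        List.filterMap_append, ih, crossingWord, crossingWord, List.range_succ,
        List.filterMap_append]
      have h1 := sampledWord_gate_two_mul (c := c) (P := P) (x := x) (N := N) n
      have h2 := sampledWord_gate_two_mul_add_one (c := c) (P := P) hN hx n
      simp only [List.filterMap_cons, List.filterMap_nil, h1, h2, List.append_nil]
  exact this N

theorem two_mul_add_one_add_one (j : ℕ) :
    ((2 * j + 1 : ℕ) : ZMod (2 * N)) + 1 = ((2 * (j + 1) : ℕ) : ZMod (2 * N)) := by
  push_cast; ring

theorem sampledWord_valid [NeZero N] (hP : P.Finite) (hx : Function.Periodic x N)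
    (hgap : GapAtLeast c r P) (hnear : ∀ j, NearBy c r (x j) (x (j + 1))) :
    (sampledWord c P x N).Valid c P := by
  have hN := Nat.pos_of_neZero N
  have g0 := sampledWord_gate_two_mul (c := c) (P := P) (x := x) (N := N)
  have g1 := sampledWord_gate_two_mul_add_one (c := c) (P := P) hN hx
  have l0 := sampledWord_label_two_mul (c := c) (P := P) hx
  have l1 := sampledWord_label_two_mul_add_one (c := c) (P := P) hN hx
  have s0 : ∀ j : ℕ, ((2 * j : ℕ) : ZMod (2 * N)) + 1 = ((2 * j + 1 : ℕ) : ZMod (2 * N)) :=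
    fun j => (Nat.cast_succ _).symm
  have s1 := two_mul_add_one_add_one (N := N)
  constructor
  · refine forall_zmod_two_mul (fun j _ => ?_) fun j h => ?_
    · rw [s0, l1, l0]
    · rw [g1] at h
      rw [s1, l1, l0, labelAt_eq_of_crossing_eq_none h]
  · refine forall_zmod_two_mul (fun j a h => ?_) fun j a h => ?_
    · cases (g0 j).symm.trans h
    · exact (crossing_spec hgap (hnear j) (g1 j ▸ h)).1
  · refine forall_zmod_two_mul (fun j a h => ?_) fun j a h => ?_
    · cases (g0 j).symm.trans h
    · rw [l1]; exact (crossing_spec hgap (hnear j) (g1 j ▸ h)).2.1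
  · refine forall_zmod_two_mul (fun j a h => ?_) fun j a h => ?_
    · cases (g0 j).symm.trans h
    · rw [s1, l0]; exact (crossing_spec hgap (hnear j) (g1 j ▸ h)).2.2.1
  · refine forall_zmod_two_mul (fun j => ?_) fun j => ?_
    · rw [l0]; exact openSlab_labelAt_nonempty hP _
    · rw [l1]; exact openSlab_labelAt_nonempty hP _
  · refine forall_zmod_two_mul (fun j => Or.inl (g0 j)) fun j => Or.inr ?_
    rw [s1, g0]

end SampledWord

end

section

open Set Filter Topology

variable {c r : ℝ} {P : Set Pt} {N : ℕ}

theorem exists_toFun_interleave_eq [NeZero N] {a b : ℕ → Pt} (ha : Function.Periodic a N)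
    (hb : Function.Periodic b N) (s : ℝ) :
    ∃ (j : ℕ) (q : ℤ) (u : ℝ), 0 ≤ u ∧ u ≤ 1 ∧ (j : ℝ) / N ≤ s - q ∧ s - q ≤ (j + 1 : ℕ) / N ∧
      (PLLoop.toFun ⟨2 * N, Nat.pos_of_neZero _, interleave a b N⟩ s = (1 - u) • a j + u • b j ∨
      PLLoop.toFun ⟨2 * N, Nat.pos_of_neZero _, interleave a b N⟩ s =
        (1 - u) • b j + u • a (j + 1)) := by
  have hN := Nat.pos_of_neZero N
  have hN' : (0 : ℝ) < N := by exact_mod_cast hN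
  set Y : PLLoop := ⟨2 * N, Nat.pos_of_neZero _, interleave a b N⟩ with hY
  have e1 : Y.toFun s = Y.toFun (Int.fract s) := by simp [PLLoop.toFun]
  have h0 : 0 ≤ Int.fract s * (2 * N : ℕ) := mul_nonneg (Int.fract_nonneg s) (Nat.cast_nonneg _)
  have h1 := Nat.floor_le h0
  have h2 := (Nat.lt_floor_add_one (Int.fract s * (2 * N : ℕ))).le
  set i := ⌊Int.fract s * (2 * N : ℕ)⌋₊ with hi
  have e2 := Y.toFun_of_mem_Icc (i : ℤ) (s := Int.fract s) (by exact_mod_cast h1)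
    (by exact_mod_cast h2)
  rw [e1, e2]
  simp only [Int.cast_natCast]
  push_cast at h1 h2
  have hu0 : 0 ≤ Int.fract s * (Y.m : ℝ) - i := by simp only [hY]; push_cast; linarith
  have hu1 : Int.fract s * (Y.m : ℝ) - i ≤ 1 := by simp only [hY]; push_cast; linarith
  rcases Nat.even_or_odd' i with ⟨j, hj | hj⟩
  · have e3 : Y.v (i : ZMod (2 * N)) = a j := by rw [hj]; exact interleave_two_mul ha j
    have e4 : Y.v ((i : ZMod (2 * N)) + 1) = b j := by
      rw [hj, ← Nat.cast_succ]; exact interleave_two_mul_add_one hN hb j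
    refine ⟨j, ⌊s⌋, _, hu0, hu1, ?_, ?_, Or.inl (by rw [e3, e4])⟩
    · rw [div_le_iff₀ hN', Int.self_sub_floor]; rw [hj] at h1; push_cast at h1; linarith
    · rw [le_div_iff₀ hN', Int.self_sub_floor]; rw [hj] at h2; push_cast at h2 ⊢; linarith
  · have e3 : Y.v (i : ZMod (2 * N)) = b j := by
      rw [hj]; exact interleave_two_mul_add_one hN hb j
    have e4 : Y.v ((i : ZMod (2 * N)) + 1) = a (j + 1) := by
      rw [hj, two_mul_add_one_add_one]; exact interleave_two_mul ha (j + 1)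
    refine ⟨j, ⌊s⌋, _, hu0, hu1, ?_, ?_, Or.inr (by rw [e3, e4])⟩
    · rw [div_le_iff₀ hN', Int.self_sub_floor]; rw [hj] at h1; push_cast at h1; linarith
    · rw [le_div_iff₀ hN', Int.self_sub_floor]; rw [hj] at h2; push_cast at h2 ⊢; linarith

theorem length_interleave_self [NeZero N] {a : ℕ → Pt} (ha : Function.Periodic a N) :
    PLLoop.length ⟨2 * N, Nat.pos_of_neZero _, interleave a a N⟩ =
      ∑ j ∈ Finset.range N, dist (a j) (a (j + 1)) := by
  have hN := Nat.pos_of_neZero N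
  have key : ∀ n : ℕ, ∑ i ∈ Finset.range (2 * n),
      dist (interleave a a N (i : ZMod (2 * N))) (interleave a a N ((i : ZMod (2 * N)) + 1)) =
      ∑ j ∈ Finset.range n, dist (a j) (a (j + 1)) := by
    intro n
    induction n with
    | zero => simp
    | succ n ih =>
      rw [mul_add, mul_one, Finset.sum_range_succ, Finset.sum_range_succ, ih,
        Finset.sum_range_succ, two_mul_add_one_add_one, ← Nat.cast_succ,
        interleave_two_mul ha, interleave_two_mul ha, Nat.succ_eq_add_one,
        interleave_two_mul_add_one hN ha, dist_self, add_zero]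
  exact key N

theorem periodic_sample {E : Type*} [NeZero N] {h : ℝ → E} (hper : Function.Periodic h 1) :
    Function.Periodic (fun j : ℕ => h ((j : ℝ) / N)) N := by
  have hN' : (N : ℝ) ≠ 0 := NeZero.ne _
  intro j
  change h (((j + N : ℕ) : ℝ) / N) = h ((j : ℝ) / N)
  rw [Nat.cast_add, add_div, div_self hN', hper]

theorem sampledWord_realizes [NeZero N] {γ : PLLoop} (hP : P.Finite) (hc : InjOn (skewCoord c) P)
    {h : ℝ → Pt} (hγ : HomotopicCurves P γ.toFun h) (hcont : Continuous h)
    (hper : Function.Periodic h 1) (hr : 0 < r) (hgap : GapAtLeast c r P)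
    (hfar : ∀ s, FarFrom c r P (h s))
    (hnear : ∀ s s' : ℝ, |s - s'| ≤ 1 / (N : ℝ) → NearBy c r (h s) (h s')) :
    (sampledWord c P (fun j : ℕ => h ((j : ℝ) / N)) N).Realizes c P γ := by
  have hN := Nat.pos_of_neZero N
  have hN' : (0 : ℝ) < N := by exact_mod_cast hN
  set x : ℕ → Pt := fun j => h ((j : ℝ) / N) with hx
  have hxper : Function.Periodic x N := periodic_sample hper
  have hstep : ∀ j, NearBy c r (x j) (x (j + 1)) := fun j => hnear _ _ (by
    rw [Nat.cast_succ, div_sub_div_same, abs_div, abs_of_pos hN']; simp)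
  have hex : ∀ y y' : Pt, ∃ z, FarFrom c r P y → NearBy c r y y' →
      NearBy c r y z ∧ NearBy c r y' z ∧ (crossing c P y y' = none → z = y) ∧
      ∀ a, crossing c P y y' = some a → z ∈ a.ray c := by
    intro y y'
    by_cases hyy : FarFrom c r P y ∧ NearBy c r y y'
    · obtain ⟨z, hz⟩ := exists_mem_ray_of_crossing hgap hyy.1 hyy.2
      exact ⟨z, fun _ _ => hz⟩
    · exact ⟨y, fun h1 h2 => absurd ⟨h1, h2⟩ hyy⟩
  choose ζ hζ using hex
  set z : ℕ → Pt := fun j => ζ (x j) (x (j + 1)) with hz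
  have hzper : Function.Periodic z N := fun j => by
    have := hxper (j + 1)
    simp only [hz, hxper j, add_right_comm j N 1, this]
  have hzj := fun j : ℕ => hζ (x j) (x (j + 1)) (hfar _) (hstep j)
  have s0 : ∀ j : ℕ, ((2 * j : ℕ) : ZMod (2 * N)) + 1 = ((2 * j + 1 : ℕ) : ZMod (2 * N)) :=
    fun j => (Nat.cast_succ _).symm
  have s1 := two_mul_add_one_add_one (N := N)
  have hrefl := fun j : ℕ => NearBy.refl (c := c) hr (x j)
  have hrefl' : ∀ j, NearBy c r (x (j + 1)) (x (j + 1)) := fun j => hrefl _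
  have i0 := interleave_two_mul (b := z) hxper
  have i1 := interleave_two_mul_add_one (a := x) hN hzper
  refine (sampledWord_valid hP hxper hgap hstep).realizes hc (Y₀ := interleave x z N) ?_ ?_ ?_
  · refine forall_zmod_two_mul (fun j => ?_) fun j => ?_
    · rw [GateWord.cell_none (sampledWord_gate_two_mul j), sampledWord_label_two_mul hxper, i0]
      exact fun q hq => ⟨fun h => h.2, fun h => (not_le.1 fun h' => h ⟨hq, h'⟩).le⟩
    · rw [i1]
      have hg := sampledWord_gate_two_mul_add_one (c := c) (P := P) hN hxper j
      rcases hcr : crossing c P (x j) (x (j + 1)) with _ | a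
      · rw [GateWord.cell_none (hg.trans hcr), sampledWord_label_two_mul_add_one hN hxper,
          show z j = x j from (hzj j).2.2.1 hcr]
        exact fun q hq => ⟨fun h => h.2, fun h => (not_le.1 fun h' => h ⟨hq, h'⟩).le⟩
      · rw [GateWord.cell_some (hg.trans hcr)]
        exact (hzj j).2.2.2 a hcr
  · refine forall_zmod_two_mul (fun j u hu0 hu1 => ?_) fun j u hu0 hu1 => ?_
    · rw [s0, i0, i1]
      exact (hfar ((j : ℝ) / N)).notMem_of_nearBy hr ((hrefl j).combo (hzj j).1 hu0 hu1)
    · rw [s1, i0, i1]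
      exact (hfar _).notMem_of_nearBy hr ((hzj j).2.1.combo (hrefl' j) hu0 hu1)
  · refine homotopicRelExt_iff.2 (hγ.lineTo hcont (PLLoop.continuous_toFun _) hper
      (PLLoop.toFun_add_one _) fun t s ht0 ht1 => ?_)
    obtain ⟨j, q, u, hu0, hu1, hq0, hq1, hs⟩ := exists_toFun_interleave_eq hxper hzper s
    have e : h s = h (s - q) := by simpa using (hper.sub_int_mul_eq (x := s) q).symm
    have hd : NearBy c r (x j) (h s) := by
      rw [e]
      refine hnear _ _ ?_
      push_cast [add_div] at hq1
      rw [abs_le]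
      constructor
      · linarith
      · have : (0 : ℝ) < 1 / N := by positivity
        linarith
    refine (hfar _).notMem_of_nearBy hr (hd.combo ?_ ht0 ht1.le)
    rcases hs with hs | hs <;> rw [hs]
    · exact (hrefl j).combo (hzj j).1 hu0 hu1
    · exact (hzj j).1.combo (hstep j) hu0 hu1

theorem exists_injOn_skewCoord {S : Set Pt} (hS : S.Finite) : ∃ c, InjOn (skewCoord c) S := by
  obtain ⟨c, hc⟩ := ((hS.prod hS).image fun z : Pt × Pt =>
    -(z.1 0 - z.2 0) / (z.1 1 - z.2 1)).exists_notMem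
  refine ⟨c, fun p hp q hq h => ?_⟩
  by_cases h1 : p 1 = q 1
  · exact ext_skewCoord h h1
  · refine absurd ⟨(p, q), ⟨hp, hq⟩, ?_⟩ hc
    have h1 := sub_ne_zero.2 h1
    simp only [skewCoord] at h
    field_simp
    linarith

end

section

open Set Filter Topology

variable {c : ℝ} {P : Set Pt} {N : ℕ}

theorem Snapped.mem_slab {η : ℝ} {x z Z : Pt} (hxz : NearBy c (η / 2) x z)
    (h : Snapped c η P z Z) : Z ∈ slab c P (labelAt c P x) := by
  have hη := (abs_nonneg _).trans_lt hxz.1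
  obtain ⟨h1, h2⟩ := abs_lt.1 hxz.1
  refine fun q hq => ⟨fun hqx => ?_, fun hqx => ?_⟩
  · have h3 : skewCoord c q ≤ skewCoord c x := hqx.2
    by_cases h4 : skewCoord c q + η ≤ skewCoord c z
    · exact (h q hq).1 h4
    · exact ((h q hq).2.2 (abs_lt.2 ⟨by linarith, by linarith⟩)).1.ge
  · have h3 : skewCoord c x < skewCoord c q := not_le.1 fun h' => hqx ⟨hq, h'⟩
    by_cases h4 : skewCoord c z ≤ skewCoord c q - η
    · exact (h q hq).2.1 h4
    · exact ((h q hq).2.2 (abs_lt.2 ⟨by linarith, by linarith⟩)).1.le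

theorem Snapped.mem_ray_of_crossing {r η : ℝ} (hr : r ≤ η / 2) (hgap : GapAtLeast c r P)
    {x y z Z : Pt} (hxy : NearBy c r x y) (hxz : NearBy c (η / 2) x z) (h : Snapped c η P z Z)
    {a : Gate} (ha : crossing c P x y = some a) : Z ∈ a.ray c := by
  obtain ⟨haP, -, -, hpx, -, -, hside⟩ := crossing_spec hgap hxy ha
  obtain ⟨h1, h2⟩ := abs_lt.1 hxz.1
  obtain ⟨h3, h4⟩ := abs_lt.1 hxz.2
  obtain ⟨h5, h6⟩ := abs_lt.1 hpx
  obtain ⟨h7, h8, h9⟩ := (h _ haP).2.2 (abs_lt.2 ⟨by linarith, by linarith⟩)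
  refine ⟨h7, ?_⟩
  rw [hside]
  by_cases hlt : a.1.1 1 < x 1
  · simpa [hlt] using h8 (by linarith)
  · simpa [hlt] using h9 (by linarith)

theorem mem_sampledWord_cell [NeZero N] {r η : ℝ} {x z : ℕ → Pt} (hx : Function.Periodic x N)
    (hz : Function.Periodic z N) (hr : r ≤ η / 2) (hgap : GapAtLeast c r P)
    (hnear : ∀ j, NearBy c r (x j) (x (j + 1)))
    (h : ∀ j, ∃ y, NearBy c (η / 2) (x j) y ∧ Snapped c η P y (z j)) (i : ZMod (2 * N)) :
    interleave z z N i ∈ (sampledWord c P x N).cell c P i := by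
  have hN := Nat.pos_of_neZero N
  revert i
  refine forall_zmod_two_mul (fun j => ?_) (fun j => ?_) <;> obtain ⟨y, hy, hyz⟩ := h j
  · rw [GateWord.cell_none (sampledWord_gate_two_mul j), sampledWord_label_two_mul hx,
      interleave_two_mul hz]
    exact hyz.mem_slab hy
  · rw [interleave_two_mul_add_one hN hz]
    have hg := sampledWord_gate_two_mul_add_one (c := c) (P := P) hN hx j
    rcases hcr : crossing c P (x j) (x (j + 1)) with _ | a
    · rw [GateWord.cell_none (hg.trans hcr), sampledWord_label_two_mul_add_one hN hx]
      exact hyz.mem_slab hy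
    · rw [GateWord.cell_some (hg.trans hcr)]
      exact hyz.mem_ray_of_crossing hr hgap (hnear j) hy hcr

theorem dist_toFun_interleave_le [NeZero N] {z : ℕ → Pt} (hz : Function.Periodic z N) {f : ℝ → Pt}
    (hf : Function.Periodic f 1) {ε : ℝ} (hzf : ∀ j : ℕ, dist (f ((j : ℝ) / N)) (z j) ≤ ε / 2)
    (hff : ∀ s s' : ℝ, |s - s'| ≤ 1 / (N : ℝ) → dist (f s) (f s') ≤ ε / 2) (s : ℝ) :
    dist (PLLoop.toFun ⟨2 * N, Nat.pos_of_neZero _, interleave z z N⟩ s) (f s) ≤ ε := by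
  obtain ⟨j, q, u, hu0, hu1, hq0, hq1, hs⟩ := exists_toFun_interleave_eq hz hz s
  have e : f s = f (s - q) := by simpa using (hf.sub_int_mul_eq (x := s) q).symm
  have key : ∀ k : ℕ, |(k : ℝ) / N - (s - q)| ≤ 1 / (N : ℝ) → z k ∈ Metric.closedBall (f s) ε := by
    intro k hk
    rw [Metric.mem_closedBall, e]
    have := dist_triangle_left (z k) (f (s - q)) (f ((k : ℝ) / N))
    linarith [hzf k, hff _ _ hk]
  have hN : (0 : ℝ) ≤ 1 / N := by positivity
  rw [Nat.cast_succ, add_div] at hq1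
  have h0 := key j (abs_le.2 ⟨by linarith, by linarith⟩)
  have h1 := key (j + 1) (by
    rw [Nat.cast_succ, add_div]
    exact abs_le.2 ⟨by linarith, by linarith⟩)
  rw [← Metric.mem_closedBall]
  rcases hs with hs | hs <;> rw [hs]
  · exact convex_closedBall _ _ h0 h0 (by linarith) hu0 (by ring)
  · exact convex_closedBall _ _ h0 h1 (by linarith) hu0 (by ring)

/-- The curves of a homotopy are eventually close to its end. -/
theorem exists_forall_nearBy {H : ℝ × ℝ → Pt} (hH : Continuous H)
    (hper : ∀ t s, H (t, s + 1) = H (t, s)) {r : ℝ} (hr : 0 < r) (c : ℝ) :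
    ∃ T : ℝ, 0 ≤ T ∧ T < 1 ∧ ∀ s, NearBy c r (H (T, s)) (H (1, s)) := by
  have hg : Continuous fun z => (skewCoord c (H z), H z 1) := by
    have := continuous_skewCoord c
    fun_prop
  obtain ⟨d, hd, h⟩ := Metric.uniformContinuousOn_iff.1
    ((isCompact_Icc (a := (0 : ℝ)) (b := 1)).prod
      (isCompact_Icc (a := (0 : ℝ)) (b := 1)) |>.uniformContinuousOn_of_continuous
        hg.continuousOn) r hr
  have hT : max 0 (1 - d / 2) < 1 := max_lt one_pos (by linarith)
  refine ⟨max 0 (1 - d / 2), le_max_left _ _, hT, fun s => ?_⟩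
  have hfr : ∀ t, H (t, s) = H (t, Int.fract s) := fun t => by
    have : Function.Periodic (fun s => H (t, s)) 1 := hper t
    simpa using (this.sub_int_mul_eq (x := s) ⌊s⌋).symm
  rw [hfr, hfr 1, nearBy_iff_dist]
  have hs : Int.fract s ∈ Icc (0 : ℝ) 1 := ⟨Int.fract_nonneg s, (Int.fract_lt_one s).le⟩
  refine h _ ⟨⟨le_max_left _ _, hT.le⟩, hs⟩ _ ⟨⟨zero_le_one, le_rfl⟩, hs⟩ ?_
  rw [Prod.dist_eq, dist_self, max_eq_left dist_nonneg, Real.dist_eq, abs_of_neg (by linarith)]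
  linarith [le_max_right 0 (1 - d / 2)]

theorem exists_pos_of_uniformContinuous {E : Type*} [PseudoMetricSpace E] {f : ℝ → E}
    (hf : Continuous f) (hper : Function.Periodic f 1) {ε : ℝ} (hε : 0 < ε) :
    ∃ N₀ : ℕ, ∀ N : ℕ, N₀ ≤ N → ∀ s s' : ℝ, |s - s'| ≤ 1 / (N : ℝ) → dist (f s) (f s') < ε := by
  obtain ⟨d, hd, h⟩ := Metric.uniformContinuous_iff.1 (uniformContinuous_of_periodic hf hper) ε hε
  obtain ⟨n, hn⟩ := exists_nat_one_div_lt hd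
  refine ⟨n + 1, fun N hN s s' hs => h (hs.trans_lt (lt_of_le_of_lt ?_ hn))⟩
  have : ((n + 1 : ℕ) : ℝ) ≤ N := by exact_mod_cast hN
  push_cast at this
  gcongr

/-- A loop homotopic to `γ` in the extended sense is approximated, without changing its length,
by a loop threading the cells of a word of gates which realizes `γ`. -/
theorem exists_thread {γ δ : PLLoop} (hP : P.Finite)
    (hc : InjOn (skewCoord c) (P ∪ range δ.v)) (h : HomotopicRelExt P γ δ) {ε : ℝ} (hε : 0 < ε) :
    ∃ N₀ : ℕ, ∀ N [NeZero N], N₀ ≤ N → δ.m ∣ N →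
      ∃ (W : GateWord (2 * N)) (X : ZMod (2 * N) → Pt), W.Valid c P ∧ W.Realizes c P γ ∧
        (∀ i, X i ∈ W.cell c P i) ∧
        (∀ s, dist (PLLoop.toFun ⟨2 * N, Nat.pos_of_neZero _, X⟩ s) (δ.toFun s) ≤ ε) ∧
        PLLoop.length ⟨2 * N, Nat.pos_of_neZero _, X⟩ = δ.length ∧
        IsConj (FreeGroup.mk (crossingWord c P (fun j : ℕ => γ.toFun ((j : ℝ) / N)) N))
          (FreeGroup.mk W.letters) := by
  obtain ⟨H, hH, H0, H1, hper, hHP⟩ := h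
  have hcP : InjOn (skewCoord c) P := hc.mono subset_union_left
  obtain ⟨η, ⟨Z, hZper, hZ, hZlen⟩, hη⟩ :=
    ((eventually_exists_snapped_loop hP δ hc (half_pos hε)).and self_mem_nhdsWithin).exists
  have hη : 0 < η := hη
  obtain ⟨T, hT0, hT1, hT⟩ := exists_forall_nearBy hH hper (half_pos hη) c
  set f : ℝ → Pt := fun s => H (T, s) with hf
  have hfper : Function.Periodic f 1 := hper T
  have hfcont : Continuous f := by fun_prop
  have hδcont := δ.continuous_toFun
  have hδper : Function.Periodic δ.toFun 1 := δ.toFun_add_one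
  obtain ⟨r₀, hr₀, hgap₀, hfar₀⟩ := exists_farFrom (c := c) (K := Icc (0 : ℝ) 1)
    isCompact_Icc hfcont (fun s _ => hHP T s hT0 hT1) hP hcP
  set r := min r₀ (η / 2) with hr_def
  have hr : 0 < r := lt_min hr₀ (half_pos hη)
  have hgap : GapAtLeast c r P := hgap₀.mono (min_le_left _ _)
  have hfar : ∀ s, FarFrom c r P (f s) := fun s => by
    have : f s = f (Int.fract s) := by simpa using (hfper.sub_int_mul_eq (x := s) ⌊s⌋).symm
    rw [this]
    exact (hfar₀ _ ⟨Int.fract_nonneg s, (Int.fract_lt_one s).le⟩).mono (min_le_left _ _)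
  have hℓ := continuous_skewCoord c
  obtain ⟨N₁, hN₁⟩ := exists_pos_of_uniformContinuous (f := fun s => (skewCoord c (f s), f s 1))
    (by fun_prop) (fun s => by simp only [hfper s]) hr
  obtain ⟨N₂, hN₂⟩ := exists_pos_of_uniformContinuous hδcont hδper (half_pos hε)
  obtain ⟨N₃, hN₃⟩ := exists_isConj_crossingWord hH hper hT0 hT1.le
    (fun t s h0 h1 => hHP t s h0 (h1.trans_lt hT1)) hP hcP
  refine ⟨max N₁ (max N₂ N₃), fun N _ hN hdvd => ?_⟩
  have hNpos := Nat.pos_of_neZero N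
  have hN' : (0 : ℝ) < N := by exact_mod_cast hNpos
  have hle₁ := (le_max_left _ _).trans hN
  have hle₂ := ((le_max_left _ _).trans (le_max_right _ _)).trans hN
  have hle₃ := ((le_max_right _ _).trans (le_max_right _ _)).trans hN
  have hnear : ∀ s s' : ℝ, |s - s'| ≤ 1 / (N : ℝ) → NearBy c r (f s) (f s') := fun s s' hs =>
    nearBy_iff_dist.2 (hN₁ N hle₁ s s' hs)
  have hx : Function.Periodic (fun j : ℕ => f ((j : ℝ) / N)) N := periodic_sample hfper
  have hz : Function.Periodic (fun j : ℕ => Z ((j : ℝ) / N)) N := periodic_sample hZper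
  have hstep : ∀ j : ℕ, NearBy c r (f ((j : ℝ) / N)) (f (((j + 1 : ℕ) : ℝ) / N)) := fun j =>
    hnear _ _ (by
      rw [Nat.cast_succ, div_sub_div_same, abs_div, abs_of_pos hN']; simp)
  refine ⟨sampledWord c P (fun j : ℕ => f ((j : ℝ) / N)) N,
    interleave (fun j : ℕ => Z ((j : ℝ) / N)) (fun j : ℕ => Z ((j : ℝ) / N)) N,
    sampledWord_valid hP hx hgap hstep,
    sampledWord_realizes hP hcP ⟨fun z => H (T * z.1, z.2), by fun_prop, fun s => by simp [H0],
      fun s => by simp [hf], fun t s => hper _ _, fun t s h0 h1 => hHP _ _ (mul_nonneg hT0 h0) (by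
        nlinarith)⟩ hfcont hfper hr hgap hfar hnear,
    mem_sampledWord_cell hx hz (min_le_right _ _) hgap hstep fun j =>
      ⟨δ.toFun ((j : ℝ) / N), by rw [← H1]; exact hT _, (hZ _).2⟩,
    dist_toFun_interleave_le hz hδper (fun j => (hZ _).1) fun s s' hs => (hN₂ N hle₂ s s' hs).le,
    ?_, ?_⟩
  · obtain ⟨L, rfl⟩ := hdvd
    rw [length_interleave_self hz]
    exact hZlen L (Nat.pos_of_mul_pos_left hNpos)
  · rw [sampledWord_letters hNpos hx]
    simpa only [H0] using hN₃ N hle₃ hNpos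

end

/-- A locally shortest piecewise-linear loop homotopic rel `P`
in the extended sense to `γ` is globally shortest among all piecewise-linear loops
homotopic rel `P` in the extended sense to `γ`. -/
theorem locally_shortest_is_globally_shortest (P : Set Pt) (hP : P.Finite)
    (γ : PLLoop) (hγ : γ.image ∩ P = ∅) (δ : PLLoop)
    (hδ : HomotopicRelExt P γ δ) (hloc : IsLocallyShortest P γ δ) :
    ∀ δ' : PLLoop, HomotopicRelExt P γ δ' → δ.length ≤ δ'.length := by
  intro δ' hδ'
  obtain ⟨ε, hε, hloc⟩ := hloc
  have : NeZero δ.m := ⟨δ.m_pos.ne'⟩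
  have : NeZero δ'.m := ⟨δ'.m_pos.ne'⟩
  obtain ⟨c, hc⟩ := exists_injOn_skewCoord
    ((hP.union (Set.finite_range δ.v)).union (Set.finite_range δ'.v))
  obtain ⟨N₁, h₁⟩ := exists_thread hP (hc.mono Set.subset_union_left) hδ (half_pos hε)
  obtain ⟨N₂, h₂⟩ := exists_thread hP
    (hc.mono (Set.union_subset_union_left _ Set.subset_union_left)) hδ' one_pos
  have hM : max N₁ N₂ ≤ δ.m * δ'.m * (max N₁ N₂ + 1) :=
    (Nat.le_succ _).trans (Nat.le_mul_of_pos_left _ (Nat.mul_pos δ.m_pos δ'.m_pos))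
  obtain ⟨W, X, hW, hr, hX, hXδ, hXlen, hconj⟩ := h₁ (δ.m * δ'.m * (max N₁ N₂ + 1))
    ((le_max_left _ _).trans hM) ((dvd_mul_right _ _).mul_right _)
  obtain ⟨W₂, X₂, -, -, hX₂, -, hX₂len, hconj₂⟩ := h₂ (δ.m * δ'.m * (max N₁ N₂ + 1))
    ((le_max_right _ _).trans hM) ((dvd_mul_left _ _).mul_right _)
  have hmin : ∀ {W : GateWord _}, W.Realizes c P γ → (∀ i, X i ∈ W.cell c P i) →
      ∀ Y : ZMod _ → Pt, (∀ i, Y i ∈ W.cell c P i) →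
      δ.length ≤ PLLoop.length ⟨_, Nat.pos_of_neZero _, Y⟩ := fun hr hX Y hY =>
    IsLocallyShortest.le_length hloc hε hXδ hXlen.le fun t h0 h1 =>
      hr _ fun i => GateWord.combo_mem_cell (hX i) (hY i) h0.le h1
  obtain ⟨W', hW', hr', hX', hred, hconj'⟩ := GateWord.exists_isCyclicallyReduced
    (hc.mono (Set.subset_union_left.trans Set.subset_union_left)) W hW hr hX
    fun W _ hr hX Y hY => hXlen.trans_le (hmin hr hX Y hY)
  obtain ⟨Y, hY, hYlen⟩ := hW'.exists_length_le hred (hconj'.trans (hconj.symm.trans hconj₂)) hX₂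
  exact (hmin hr' hX' Y hY).trans (hYlen.trans_eq hX₂len)

end
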